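/- Let G be a chain graph with a set A ⊆ V(G) of variables set by intervention at x_A = a_0. Let Ĝ be obtained from G by replacing, for every u ∈ A and every undirected edge {u, w}, that edge by the directed edge u → w, and then removing all directed edges pointing to a vertex of A. Then G and Ĝ admit the same factorization decomposition: a pmf f on configurations consistent with x_A = a_0 factorizes according to (G, A) if and only if it factorizes according to (Ĝ, A). -/

import Mathlib

namespace BH

variable {V : Type*}

/-- The edge set of a directed hypergraph on vertex set `V`:
each hyperedge is an ordered pair `(tail, head)` of subsets of `V`. -/
abbrev HEdges (V : Type*) := Set (Set V × Set V)

/-- Every hyperedge has disjoint tail and head. -/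
def HDisjoint (E : HEdges V) : Prop := ∀ h ∈ E, Disjoint h.1 h.2

/-- `u` is a parent of `v` in the directed hypergraph. -/
def hPar (E : HEdges V) (u v : V) : Prop := ∃ h ∈ E, u ∈ h.1 ∧ v ∈ h.2

/-- `u` and `v` are neighbors (co-head) in the directed hypergraph. -/
def hNbr (E : HEdges V) (u v : V) : Prop := ∃ h ∈ E, u ∈ h.2 ∧ v ∈ h.2 ∧ u ≠ v

/-- A partially directed cycle with respect to a neighbor relation `nbr` and a
parent relation `par`: a cyclic sequence `v_1, …, v_k, v_{k+1} = v_1` in which every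
step is a neighbor-or-parent step and at least one step is a parent step. -/
def PDCycle (nbr par : V → V → Prop) : Prop :=
  ∃ (n : ℕ) (f : ZMod (n + 1) → V),
    (∀ i, nbr (f i) (f (i + 1)) ∨ par (f i) (f (i + 1))) ∧
    (∃ i, par (f i) (f (i + 1)))

/-- A directed hypergraph is acyclic if it has no partially directed cycle. -/
def HAcyclic (E : HEdges V) : Prop := ¬ PDCycle (hNbr E) (hPar E)

/-- Graph notions: a graph on `V` is a set of ordered pairs.
`u` is a parent of `v` if `(u,v)` is a directed edge. -/
def gPar (E : Set (V × V)) (u v : V) : Prop := (u, v) ∈ E ∧ (v, u) ∉ E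

/-- `u` and `v` are neighbors if `(u,v)` is an undirected edge. -/
def gNbr (E : Set (V × V)) (u v : V) : Prop := (u, v) ∈ E ∧ (v, u) ∈ E

/-- A chain graph is a graph with no partially directed cycle. -/
def IsChainGraph (E : Set (V × V)) : Prop := ¬ PDCycle (gNbr E) (gPar E)

/-- The shadow of a directed hypergraph: for every hyperedge `(X,Y)`, any two
distinct vertices of `Y` are joined by an undirected edge and there is a directed
edge from every vertex of `X` to every vertex of `Y`. -/
def shadow (E : HEdges V) : Set (V × V) :=
  {p | ∃ h ∈ E, (p.1 ∈ h.2 ∧ p.2 ∈ h.2 ∧ p.1 ≠ p.2) ∨ (p.1 ∈ h.1 ∧ p.2 ∈ h.2)}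

/-- Chain component of `v` in a directed hypergraph: reflexive-transitive closure
of the co-head relation. -/
def hComp (E : HEdges V) (v : V) : Set V := {u | Relation.ReflTransGen (hNbr E) v u}

/-- The set of chain components of a directed hypergraph. -/
def hComps (E : HEdges V) : Set (Set V) := {S | ∃ v, S = hComp E v}

/-- Chain component of `v` in a graph: vertices joined to `v` by undirected paths. -/
def gComp (E : Set (V × V)) (v : V) : Set V := {u | Relation.ReflTransGen (gNbr E) v u}

/-- The set of chain components of a graph. -/
def gComps (E : Set (V × V)) : Set (Set V) := {S | ∃ v, S = gComp E v}

/-- Parent set of a vertex in a hypergraph. -/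
def hPaSet (E : HEdges V) (v : V) : Set V := {u | hPar E u v}

/-- Neighbor set of a vertex in a hypergraph. -/
def hNbSet (E : HEdges V) (v : V) : Set V := {u | hNbr E u v}

/-- Parent set of a vertex in a graph. -/
def gPaSet (E : Set (V × V)) (v : V) : Set V := {u | gPar E u v}

/-- Neighbor set of a vertex in a graph. -/
def gNbSet (E : Set (V × V)) (v : V) : Set V := {u | gNbr E u v}

/-- `pa(τ)` for a vertex set `τ` in a graph. -/
def gPaTau (E : Set (V × V)) (τ : Set V) : Set V := (⋃ v ∈ τ, gPaSet E v) \ τ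

/-- `bd(τ)` for a vertex set `τ` in a graph. -/
def gBd (E : Set (V × V)) (τ : Set V) : Set V := (⋃ v ∈ τ, gPaSet E v ∪ gNbSet E v) \ τ

/-- `cl(τ) = bd(τ) ∪ τ`. -/
def gCl (E : Set (V × V)) (τ : Set V) : Set V := gBd E τ ∪ τ

/-- `pa(τ)` for a vertex set `τ` in a hypergraph. -/
def hPaTau (E : HEdges V) (τ : Set V) : Set V := (⋃ v ∈ τ, hPaSet E v) \ τ

/-- Induced subgraph on a vertex set. -/
def gInduced (E : Set (V × V)) (A : Set V) : Set (V × V) := {p ∈ E | p.1 ∈ A ∧ p.2 ∈ A}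

/-- Induced sub-hypergraph on a vertex set. -/
def hInduced (E : HEdges V) (A : Set V) : HEdges V := {h ∈ E | h.1 ∪ h.2 ⊆ A}

/-- Anterior set of `S` with respect to neighbor/parent relations: all vertices with
a neighbor-or-parent-step path to some vertex of `S` (including `S` itself). -/
def antOf (nbr par : V → V → Prop) (S : Set V) : Set V :=
  {w | ∃ s ∈ S, Relation.ReflTransGen (fun a b => nbr a b ∨ par a b) w s}

/-- Anterior set in a graph. -/
def gAnt (E : Set (V × V)) (S : Set V) : Set V := antOf (gNbr E) (gPar E) S

/-- Anterior set in a hypergraph. -/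
def hAnt (E : HEdges V) (S : Set V) : Set V := antOf (hNbr E) (hPar E) S

/-- The moral graph of a graph: its underlying undirected graph with all pairs of
distinct vertices inside `bd(τ)` joined, for every chain component `τ`. -/
def moral (E : Set (V × V)) : Set (V × V) :=
  {p | (p.1, p.2) ∈ E ∨ (p.2, p.1) ∈ E ∨
    ∃ τ ∈ gComps E, p.1 ∈ gBd E τ ∧ p.2 ∈ gBd E τ ∧ p.1 ≠ p.2}

/-- `K` is a clique with respect to the (symmetric) pair set `U`. -/
def IsCliqueIn (U : Set (V × V)) (K : Set V) : Prop :=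
  ∀ u ∈ K, ∀ v ∈ K, u ≠ v → (u, v) ∈ U

/-- `K` is a maximal clique of `U` inside the vertex set `S`. -/
def IsMaxCliqueWithin (U : Set (V × V)) (S K : Set V) : Prop :=
  K.Nonempty ∧ K ⊆ S ∧ IsCliqueIn U K ∧
    ∀ K', K ⊆ K' → K' ⊆ S → IsCliqueIn U K' → K' = K

/-- The maximal cliques of the pair set `U`. -/
def maxCliques (U : Set (V × V)) : Set (Set V) :=
  {K | IsMaxCliqueWithin U Set.univ K}

/-- The undirected part of a graph, as a set of pairs. -/
def uPart (E : Set (V × V)) : Set (V × V) := {p | gNbr E p.1 p.2}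

/-- The set of children of a vertex in a graph. -/
def children (E : Set (V × V)) (v : V) : Set V := {w | gPar E v w}

/-- Phase I, first stage of the canonical LWF DAH construction: for each vertex `v`
with children set `S_v`, the hyperedge `({v}, K)` for every maximal clique `K` of the
undirected part of `G[S_v]`. -/
def phase1a (E : Set (V × V)) : HEdges V :=
  {h | ∃ v K, IsMaxCliqueWithin (uPart E) (children E v) K ∧ h = ({v}, K)}

/-- Phase I of the canonical LWF DAH construction. -/
def phase1 (E : Set (V × V)) : HEdges V :=
  phase1a E ∪
    {h | ∃ K, IsMaxCliqueWithin (uPart E) Set.univ K ∧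
      (∀ h' ∈ phase1a E, ¬ K ⊆ h'.2) ∧ h = (∅, K)}

/-- The Phase-I hyperedges lying inside `cl(τ)` whose head meets `τ`. -/
def HstarI (E : Set (V × V)) (τ : Set V) : HEdges V :=
  {h ∈ phase1 E | h.1 ∪ h.2 ⊆ gCl E τ ∧ (h.2 ∩ τ).Nonempty}

/-- The canonical LWF DAH of a chain graph (its set of hyperedges): for every chain
component `τ` and every nonempty family `F ⊆ H*_τ` with `B = ⋂_{h ∈ F} H(h)`, the
hyperedge `(⋃ {T(h) : h ∈ H*_τ, B ⊆ H(h)}, B)`. -/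
def canonicalLWF (E : Set (V × V)) : HEdges V :=
  {e | ∃ τ ∈ gComps E, ∃ F, F ⊆ HstarI E τ ∧ F.Nonempty ∧
    e.2 = {x | ∀ g ∈ F, x ∈ g.2} ∧
    e.1 = {x | ∃ h ∈ HstarI E τ, e.2 ⊆ h.2 ∧ x ∈ h.1}}

/-- The hyperedges of `H[τ ∪ pa(τ)]` whose head is contained in `τ`. -/
def HstarF (E : HEdges V) (τ : Set V) : HEdges V :=
  {h ∈ hInduced E (τ ∪ hPaTau E τ) | h.2 ⊆ τ}

/-- The hyperedges of a family whose underlying vertex sets are maximal under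
set containment. -/
def maximalIn (E : HEdges V) : HEdges V :=
  {h ∈ E | ∀ h' ∈ E, h.1 ∪ h.2 ⊆ h'.1 ∪ h'.2 → h'.1 ∪ h'.2 = h.1 ∪ h.2}

/-- Descendants of `v` with respect to a parent relation. -/
def desc (par : V → V → Prop) (v : V) : Set V := {u | Relation.TransGen par v u}

/-- Non-descendants of `v`. -/
def ndOf (par : V → V → Prop) (v : V) : Set V := {u | u ∉ desc par v}

/-- Adjacency with respect to neighbor/parent relations. -/
def adjOf (nbr par : V → V → Prop) (u v : V) : Prop := par u v ∨ par v u ∨ nbr u v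

/-- Boundary of a vertex. -/
def bdOf (nbr par : V → V → Prop) (v : V) : Set V := {u | par u v} ∪ {u | nbr u v}

/-- Closure of a vertex. -/
def clOf (nbr par : V → V → Prop) (v : V) : Set V := bdOf nbr par v ∪ {v}

/-- `C` separates `A` and `B` in the undirected graph with pair set `U`:
every path from `A` to `B` meets `C`. -/
def Separates (U : Set (V × V)) (A B C : Set V) : Prop :=
  ∀ (n : ℕ) (f : Fin (n + 1) → V), f 0 ∈ A → f (Fin.last n) ∈ B →
    (∀ i : Fin n, (f i.castSucc, f i.succ) ∈ U) → ∃ i, f i ∈ C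

section Prob

variable [Fintype V] [DecidableEq V] {X : V → Type*} [∀ v, Fintype (X v)]

/-- `p` is a probability mass function. -/
def IsPMF (p : (∀ v, X v) → ℝ) : Prop := (∀ x, 0 ≤ p x) ∧ ∑ x, p x = 1

/-- Marginal of `p` on the coordinates in `S`, evaluated at `x`. -/
noncomputable def marginal (p : (∀ v, X v) → ℝ) (S : Set V) (x : ∀ v, X v) : ℝ :=
  ∑ y, Set.indicator {z : ∀ v, X v | ∀ v ∈ S, z v = x v} p y

/-- Conditional independence `A ⟂ B | C` for the pmf `p`. -/
def CI (p : (∀ v, X v) → ℝ) (A B C : Set V) : Prop :=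
  ∀ x, marginal p (A ∪ B ∪ C) x * marginal p C x
      = marginal p (A ∪ C) x * marginal p (B ∪ C) x

/-- The intersection property (S5). -/
def S5 (p : (∀ v, X v) → ℝ) : Prop :=
  ∀ A B C D : Set V, Disjoint A B → Disjoint A C → Disjoint A D →
    Disjoint B C → Disjoint B D → Disjoint C D →
    CI p A B (D ∪ C) → CI p A D (B ∪ C) → CI p A (B ∪ D) C

/-- Pairwise Markov property with respect to neighbor/parent relations. -/
def PairwiseMarkov (nbr par : V → V → Prop) (p : (∀ v, X v) → ℝ) : Prop :=
  ∀ v u, v ≠ u → ¬ adjOf nbr par v u → u ∈ ndOf par v →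
    CI p {v} {u} (ndOf par v \ {v, u})

/-- Local Markov property with respect to neighbor/parent relations. -/
def LocalMarkov (nbr par : V → V → Prop) (p : (∀ v, X v) → ℝ) : Prop :=
  ∀ v, CI p {v} (ndOf par v \ clOf nbr par v) (bdOf nbr par v)

/-- Global Markov property relative to a chain graph. -/
def GlobalMarkovG (E : Set (V × V)) (p : (∀ v, X v) → ℝ) : Prop :=
  ∀ A B C : Set V, Disjoint A B → Disjoint A C → Disjoint B C →
    Separates (moral (gInduced E (gAnt E (A ∪ B ∪ C)))) A B C → CI p A B C

/-- Global Markov property relative to a directed hypergraph. -/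
def GlobalMarkovH (E : HEdges V) (p : (∀ v, X v) → ℝ) : Prop :=
  ∀ A B C : Set V, Disjoint A B → Disjoint A C → Disjoint B C →
    Separates (moral (shadow (hInduced E (hAnt E (A ∪ B ∪ C))))) A B C → CI p A B C

/-- `f` depends only on the coordinates in `S`. -/
def DependsOn (f : (∀ v, X v) → ℝ) (S : Set V) : Prop :=
  ∀ x y, (∀ v ∈ S, x v = y v) → f x = f y

/-- Conditional pmf `p(x_S | x_T)` as a ratio of marginals. -/
noncomputable def condM (p : (∀ v, X v) → ℝ) (S T : Set V) (x : ∀ v, X v) : ℝ :=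
  marginal p (S ∪ T) x / marginal p T x

/-- Sum of `F` over the coordinates in `τ`, the remaining coordinates fixed at `x`. -/
noncomputable def sumOver (τ : Set V) (F : (∀ v, X v) → ℝ) (x : ∀ v, X v) : ℝ :=
  ∑ y, Set.indicator {z : ∀ v, X v | ∀ v, v ∉ τ → z v = x v} F y

/-- Factorization (CF) of a pmf according to a chain graph. -/
def FactorizesCG (E : Set (V × V)) (p : (∀ v, X v) → ℝ) : Prop :=
  (∀ x, p x = ∏ᶠ τ ∈ gComps E, condM p τ (gPaTau E τ) x) ∧
  ∀ τ ∈ gComps E, ∃ ψ : Set V → (∀ v, X v) → ℝ,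
    (∀ K ∈ maxCliques (moral (gInduced E (τ ∪ gPaTau E τ))),
      (∀ x, 0 ≤ ψ K x) ∧ DependsOn (ψ K) K) ∧
    ∀ x, condM p τ (gPaTau E τ) x
      = (∏ᶠ K ∈ maxCliques (moral (gInduced E (τ ∪ gPaTau E τ))), ψ K x) /
        sumOver τ (fun y => ∏ᶠ K ∈ maxCliques (moral (gInduced E (τ ∪ gPaTau E τ))), ψ K y) x

/-- Factorization (HF) of a pmf according to a directed acyclic hypergraph. -/
def FactorizesBH (E : HEdges V) (p : (∀ v, X v) → ℝ) : Prop :=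
  (∀ x, p x = ∏ᶠ τ ∈ hComps E, condM p τ (hPaTau E τ) x) ∧
  ∀ τ ∈ hComps E, ∃ ψ : Set V × Set V → (∀ v, X v) → ℝ,
    (∀ h ∈ maximalIn (HstarF E τ), (∀ x, 0 ≤ ψ h x) ∧ DependsOn (ψ h) (h.1 ∪ h.2)) ∧
    (∀ x, condM p τ (hPaTau E τ) x = ∏ᶠ h ∈ maximalIn (HstarF E τ), ψ h x) ∧
    (∀ x, sumOver τ (fun y => ∏ᶠ h ∈ maximalIn (HstarF E τ), ψ h y) x = 1)

/-- Factorization of a pmf according to a chain graph with intervened set `A`. -/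
def FactorizesCGInt (E : Set (V × V)) (A : Set V) (f : (∀ v, X v) → ℝ) : Prop :=
  (∀ x, f x = ∏ᶠ τ ∈ gComps E, condM f (τ \ A) (gPaTau E τ ∪ (τ ∩ A)) x) ∧
  ∀ τ ∈ gComps E, ∃ ψ : Set V → (∀ v, X v) → ℝ,
    (∀ K ∈ maxCliques (moral (gInduced E (τ ∪ gPaTau E τ))),
      (∀ x, 0 ≤ ψ K x) ∧ DependsOn (ψ K) K) ∧
    ∀ x, condM f (τ \ A) (gPaTau E τ ∪ (τ ∩ A)) x
      = (∏ᶠ K ∈ maxCliques (moral (gInduced E (τ ∪ gPaTau E τ))), ψ K x) /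
        sumOver (τ \ A)
          (fun y => ∏ᶠ K ∈ maxCliques (moral (gInduced E (τ ∪ gPaTau E τ))), ψ K y) x

/-- Factorization of a pmf according to a directed acyclic hypergraph with
intervened set `A`. -/
def FactorizesBHInt (E : HEdges V) (A : Set V) (f : (∀ v, X v) → ℝ) : Prop :=
  (∀ x, f x = ∏ᶠ τ ∈ hComps E, condM f (τ \ A) (hPaTau E τ ∪ (τ ∩ A)) x) ∧
  ∀ τ ∈ hComps E, ∃ ψ : Set V × Set V → (∀ v, X v) → ℝ,
    (∀ h ∈ maximalIn (HstarF E τ), (∀ x, 0 ≤ ψ h x) ∧ DependsOn (ψ h) (h.1 ∪ h.2)) ∧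
    ∀ x, condM f (τ \ A) (hPaTau E τ ∪ (τ ∩ A)) x
      = (∏ᶠ h ∈ maximalIn (HstarF E τ), ψ h x) /
        sumOver (τ \ A) (fun y => ∏ᶠ h ∈ maximalIn (HstarF E τ), ψ h y) x

/-- `f` is supported on configurations consistent with the intervention `x_A = a₀`. -/
def ConsistentWith (f : (∀ v, X v) → ℝ) (A : Set V) (a0 : ∀ v, X v) : Prop :=
  ∀ x, f x ≠ 0 → ∀ v ∈ A, x v = a0 v

end Prob

end BH

namespace BH

/-- The redirection procedure for chain graphs: for every `u ∈ A` and every undirected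
edge `{u, w}`, replace that edge by the directed edge `u → w` (i.e., delete `(w, u)`),
and then remove all directed edges pointing to a vertex of `A`. -/
def redirectCG (E : Set (V × V)) (A : Set V) : Set (V × V) :=
  (E \ {p | p.2 ∈ A ∧ (p.1, p.2) ∈ E ∧ (p.2, p.1) ∈ E}) \
    {p | p.2 ∈ A ∧ (p.2, p.1) ∉ E \ {q | q.2 ∈ A ∧ (q.1, q.2) ∈ E ∧ (q.2, q.1) ∈ E}}

end BH

namespace BH

section Graph

variable {V : Type*} {E : Set (V × V)} {A : Set V} {r : V → ℕ}

/-- `r` is constant along undirected edges and increases strictly along directed ones. -/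
structure IsRank (E : Set (V × V)) (r : V → ℕ) : Prop where
  eq_of_nbr : ∀ u v, gNbr E u v → r u = r v
  lt_of_par : ∀ u v, gPar E u v → r u < r v

lemma exists_seq_of_reflTransGen {R : V → V → Prop} {a b : V}
    (h : Relation.ReflTransGen R a b) :
    ∃ (n : ℕ) (g : ℕ → V), g 0 = a ∧ g n = b ∧ ∀ i < n, R (g i) (g (i + 1)) := by
  induction h with
  | refl => exact ⟨0, fun _ => a, rfl, rfl, by simp⟩
  | @tail b c _ hbc ih =>
    obtain ⟨n, g, h0, hn, hg⟩ := ih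
    refine ⟨n + 1, fun i => if i ≤ n then g i else c, by simp [h0], by simp, fun i hi => ?_⟩
    rcases Nat.lt_succ_iff_lt_or_eq.1 hi with hi | rfl
    · simpa [hi.le, Nat.succ_le_of_lt hi] using hg i hi
    · simpa [hn] using hbc

lemma pdCycle_of_reflTransGen {nbr par : V → V → Prop} {u v : V}
    (h : Relation.ReflTransGen (fun a b => nbr a b ∨ par a b) v u) (huv : par u v) :
    PDCycle nbr par := by
  obtain ⟨n, g, h0, hn, hg⟩ := exists_seq_of_reflTransGen h
  have hstep : ∀ i : ZMod (n + 1), (i.val < n ∧ (i + 1).val = i.val + 1) ∨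
      (i.val = n ∧ (i + 1).val = 0) := by
    intro i
    rcases Nat.lt_succ_iff_lt_or_eq.1 (ZMod.val_lt i) with hi | hi
    · left
      refine ⟨hi, ?_⟩
      have : i + 1 = ((i.val + 1 : ℕ) : ZMod (n + 1)) := by simp
      rw [this, ZMod.val_natCast_of_lt (Nat.succ_lt_succ hi)]
    · right
      refine ⟨hi, ?_⟩
      have : i + 1 = ((i.val + 1 : ℕ) : ZMod (n + 1)) := by simp
      rw [this, hi, ZMod.natCast_self, ZMod.val_zero]
  have hlast : ∀ i : ZMod (n + 1), i.val = n → (i + 1).val = 0 → par (g i.val) (g (i + 1).val) := by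
    intro i h1 h2
    rw [h1, h2, h0, hn]
    exact huv
  refine ⟨n, fun i => g i.val, fun i => ?_, ((n : ℕ) : ZMod (n + 1)), ?_⟩
  · rcases hstep i with ⟨h1, h2⟩ | ⟨h1, h2⟩
    · simp only [h2]
      exact hg _ h1
    · exact Or.inr (hlast i h1 h2)
  · have hval : ((n : ℕ) : ZMod (n + 1)).val = n := ZMod.val_natCast_of_lt n.lt_succ_self
    rcases hstep (n : ℕ) with ⟨h1, -⟩ | ⟨h1, h2⟩
    · omega
    · exact hlast _ h1 h2

lemma exists_isRank [Finite V] (hE : IsChainGraph E) : ∃ r, IsRank E r := by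
  let R : V → V → Prop := Relation.ReflTransGen fun a b => gNbr E a b ∨ gPar E a b
  have hsub : ∀ {u v}, R u v → {w | R w u} ⊆ {w | R w v} := fun h w hw => hw.trans h
  refine ⟨fun v => {u | R u v}.ncard, fun u v h => ?_, fun u v h => ?_⟩
  · have : {w | R w u} = {w | R w v} :=
      (hsub (.single (.inl h))).antisymm (hsub (.single (.inl ⟨h.2, h.1⟩)))
    simp only [this]
  · refine Set.ncard_lt_ncard ((Set.ssubset_iff_of_subset (hsub (.single (.inr h)))).2
      ⟨v, .refl, fun hvu => hE (pdCycle_of_reflTransGen hvu h)⟩) (Set.toFinite _)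

lemma gNbr.symm {u v : V} (h : gNbr E u v) : gNbr E v u := ⟨h.2, h.1⟩

instance : Std.Symm (gNbr E) := ⟨fun _ _ => gNbr.symm⟩

lemma mem_gComp_self (v : V) : v ∈ gComp E v := Relation.ReflTransGen.refl

lemma gComp_eq_of_mem {u v : V} (h : u ∈ gComp E v) : gComp E u = gComp E v := by
  have hs : Relation.ReflTransGen (gNbr E) u v :=
    Std.Symm.symm _ _ h
  ext w
  exact ⟨fun hw => Relation.ReflTransGen.trans h hw, fun hw => hs.trans hw⟩

lemma eq_gComp_of_mem {τ : Set V} (hτ : τ ∈ gComps E) {v : V} (hv : v ∈ τ) : τ = gComp E v := by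
  obtain ⟨w, rfl⟩ := hτ
  exact (gComp_eq_of_mem hv).symm

lemma gComps_eq_of_mem {τ τ' : Set V} (hτ : τ ∈ gComps E) (hτ' : τ' ∈ gComps E) {v : V}
    (hv : v ∈ τ) (hv' : v ∈ τ') : τ = τ' :=
  (eq_gComp_of_mem hτ hv).trans (eq_gComp_of_mem hτ' hv').symm

lemma gComps_disjoint {τ τ' : Set V} (hτ : τ ∈ gComps E) (hτ' : τ' ∈ gComps E) (h : τ ≠ τ') :
    Disjoint τ τ' :=
  Set.disjoint_left.2 fun _ hv hv' => h (gComps_eq_of_mem hτ hτ' hv hv')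

lemma gComps_nonempty {τ : Set V} (hτ : τ ∈ gComps E) : τ.Nonempty := by
  obtain ⟨w, rfl⟩ := hτ
  exact ⟨w, mem_gComp_self w⟩

lemma gComp_mem_gComps (v : V) : gComp E v ∈ gComps E := ⟨v, rfl⟩

lemma mem_of_gNbr {τ : Set V} (hτ : τ ∈ gComps E) {u v : V} (hu : u ∈ τ) (h : gNbr E u v) :
    v ∈ τ := by
  rw [eq_gComp_of_mem hτ hu]
  exact Relation.ReflTransGen.single h

lemma IsRank.eq_of_mem (hr : IsRank E r) {τ : Set V} (hτ : τ ∈ gComps E) {u v : V} (hu : u ∈ τ)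
    (hv : v ∈ τ) : r u = r v := by
  rw [eq_gComp_of_mem hτ hu] at hv
  induction hv with
  | refl => rfl
  | tail _ h ih => exact ih.trans (hr.eq_of_nbr _ _ h)

lemma mem_gPaTau {τ : Set V} {u : V} : u ∈ gPaTau E τ ↔ (∃ v ∈ τ, gPar E u v) ∧ u ∉ τ := by
  simp [gPaTau, gPaSet]

lemma IsRank.lt_of_mem_gPaTau (hr : IsRank E r) {τ : Set V} (hτ : τ ∈ gComps E) {u v : V}
    (hu : u ∈ gPaTau E τ) (hv : v ∈ τ) : r u < r v := by
  obtain ⟨⟨w, hw, huw⟩, -⟩ := mem_gPaTau.1 hu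
  exact (hr.lt_of_par _ _ huw).trans_eq (hr.eq_of_mem hτ hw hv)

lemma IsRank.edge_of_mem (hr : IsRank E r) {τ : Set V} (hτ : τ ∈ gComps E) {u v : V}
    (hu : u ∈ τ) (hv : v ∈ τ) (h : (u, v) ∈ E) : (v, u) ∈ E := by
  by_contra hvu
  exact (hr.lt_of_par u v ⟨h, hvu⟩).ne (hr.eq_of_mem hτ hu hv)

lemma IsRank.mem_gPaTau_of_edge (hr : IsRank E r) {τ : Set V} (hτ : τ ∈ gComps E) {u v : V}
    (hu : u ∈ τ ∪ gPaTau E τ) (hv : v ∈ τ)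
    (h : (u, v) ∈ E ∨ (v, u) ∈ E) : (u, v) ∈ E := by
  rcases h with h | h
  · exact h
  rcases hu with hu | hu
  · exact hr.edge_of_mem hτ hv hu h
  · by_contra huv
    exact (hr.lt_of_par v u ⟨h, huv⟩).not_gt (hr.lt_of_mem_gPaTau hτ hu hv)

lemma mem_gComps_gInduced {τ B : Set V} (hτ : τ ∈ gComps E) (hB : τ ⊆ B) :
    τ ∈ gComps (gInduced E B) := by
  obtain ⟨v, rfl⟩ := hτ
  refine ⟨v, Set.Subset.antisymm (fun u hu => ?_) (fun u hu => ?_)⟩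
  · induction hu with
    | refl => exact .refl
    | @tail b c hb hbc ih =>
      have hc : c ∈ gComp E v := Relation.ReflTransGen.tail hb hbc
      exact Relation.ReflTransGen.tail ih
        ⟨⟨hbc.1, hB hb, hB hc⟩, ⟨hbc.2, hB hc, hB hb⟩⟩
  · exact Relation.ReflTransGen.mono (fun a b (h : gNbr _ a b) => ⟨h.1.1, h.2.1⟩) _ _ hu

lemma mem_gBd {τ : Set V} (hτ : τ ∈ gComps E) {u : V} (hu : u ∈ gBd E τ) :
    ∃ w ∈ τ, gPar E u w := by
  simp only [gBd, gPaSet, gNbSet, Set.mem_sdiff, Set.mem_iUnion, Set.mem_union,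
    Set.mem_ofPred_eq] at hu
  obtain ⟨⟨w, hw, h | h⟩, hne⟩ := hu
  · exact ⟨w, hw, h⟩
  · exact absurd (mem_of_gNbr hτ hw h.symm) hne

lemma IsRank.mem_moral_iff (hr : IsRank E r) {τ : Set V} (hτ : τ ∈ gComps E) {u v : V}
    (huv : u ≠ v) :
    (u, v) ∈ moral (gInduced E (τ ∪ gPaTau E τ)) ↔
      (u ∈ gPaTau E τ ∧ v ∈ gPaTau E τ) ∨
      (u ∈ τ ∪ gPaTau E τ ∧ v ∈ τ ∧ (u, v) ∈ E) ∨
      (v ∈ τ ∪ gPaTau E τ ∧ u ∈ τ ∧ (v, u) ∈ E) := by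
  constructor
  · have key : ∀ τ' ∈ gComps (gInduced E (τ ∪ gPaTau E τ)), ∀ w,
        w ∈ gBd (gInduced E (τ ∪ gPaTau E τ)) τ' → w ∈ gPaTau E τ := by
      intro τ' hτ' w hw
      obtain ⟨z, -, ⟨⟨hwz, hwB, hzB⟩, hzw⟩⟩ := mem_gBd hτ' hw
      have hpar : gPar E w z := ⟨hwz, fun h => hzw ⟨h, hzB, hwB⟩⟩
      refine hwB.resolve_left fun hwτ => ?_
      have h1 := hr.lt_of_par _ _ hpar
      rcases hzB with hz | hz
      · exact h1.ne (hr.eq_of_mem hτ hwτ hz)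
      · exact h1.not_gt (hr.lt_of_mem_gPaTau hτ hz hwτ)
    rintro (⟨h, hu, hv⟩ | ⟨h, hv, hu⟩ | ⟨τ', hτ', hu, hv, -⟩)
    · dsimp only at h hu hv
      by_cases hvτ : v ∈ τ
      · exact .inr (.inl ⟨hu, hvτ, h⟩)
      · by_cases huτ : u ∈ τ
        · exact .inr (.inr ⟨hv, huτ, hr.mem_gPaTau_of_edge hτ hv huτ (.inr h)⟩)
        · exact .inl ⟨hu.resolve_left huτ, hv.resolve_left hvτ⟩
    · dsimp only at h hu hv
      by_cases huτ : u ∈ τ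
      · exact .inr (.inr ⟨hv, huτ, h⟩)
      · by_cases hvτ : v ∈ τ
        · exact .inr (.inl ⟨hu, hvτ, hr.mem_gPaTau_of_edge hτ hu hvτ (.inr h)⟩)
        · exact .inl ⟨hu.resolve_left huτ, hv.resolve_left hvτ⟩
    · exact .inl ⟨key τ' hτ' u hu, key τ' hτ' v hv⟩
  · have hbd : ∀ w ∈ gPaTau E τ, w ∈ gBd (gInduced E (τ ∪ gPaTau E τ)) τ := by
      intro w hw
      obtain ⟨⟨z, hz, hwz⟩, hwτ⟩ := mem_gPaTau.1 hw
      simp only [gBd, gPaSet, gNbSet, Set.mem_sdiff, Set.mem_iUnion, Set.mem_union,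
        Set.mem_ofPred_eq]
      exact ⟨⟨z, hz, .inl ⟨⟨hwz.1, .inr hw, .inl hz⟩, fun h => hwz.2 h.1⟩⟩, hwτ⟩
    rintro (⟨hu, hv⟩ | ⟨hu, hv, h⟩ | ⟨hv, hu, h⟩)
    · exact .inr (.inr ⟨τ, mem_gComps_gInduced hτ Set.subset_union_left, hbd u hu, hbd v hv, huv⟩)
    · exact .inl ⟨h, hu, .inl hv⟩
    · exact .inr (.inl ⟨h, hv, .inl hu⟩)

lemma mem_redirectCG {u v : V} : (u, v) ∈ redirectCG E A ↔ (u, v) ∈ E ∧ v ∉ A := by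
  simp only [redirectCG, Set.mem_sdiff, Set.mem_ofPred_eq]
  tauto

lemma gNbr_redirectCG {u v : V} :
    gNbr (redirectCG E A) u v ↔ gNbr E u v ∧ u ∉ A ∧ v ∉ A := by
  simp only [gNbr, mem_redirectCG]
  tauto

lemma gPar_redirectCG {u v : V} :
    gPar (redirectCG E A) u v ↔ v ∉ A ∧ (u, v) ∈ E ∧ ((v, u) ∉ E ∨ u ∈ A) := by
  simp only [gPar, mem_redirectCG]
  tauto

open scoped Classical in
lemma IsRank.redirect (hr : IsRank E r) (A : Set V) :
    IsRank (redirectCG E A) fun v => if v ∈ A then 0 else r v + 1 := by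
  refine ⟨fun u v h => ?_, fun u v h => ?_⟩
  · obtain ⟨h, hu, hv⟩ := gNbr_redirectCG.1 h
    simp [hu, hv, hr.eq_of_nbr _ _ h]
  · obtain ⟨hv, h, hor⟩ := gPar_redirectCG.1 h
    by_cases hu : u ∈ A
    · simp [hu, hv]
    · simpa [hu, hv] using hr.lt_of_par u v ⟨h, hor.resolve_right hu⟩

lemma exists_subset_of_mem_gComps_redirectCG {c : Set V} (hc : c ∈ gComps (redirectCG E A)) :
    ∃ τ ∈ gComps E, c ⊆ τ := by
  obtain ⟨v, rfl⟩ := hc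
  exact ⟨_, gComp_mem_gComps v, fun u hu =>
    Relation.ReflTransGen.mono (fun _ _ h => (gNbr_redirectCG.1 h).1) _ _ hu⟩

lemma singleton_or_disjoint_of_mem_gComps_redirectCG {c : Set V}
    (hc : c ∈ gComps (redirectCG E A)) : (∃ a ∈ A, c = {a}) ∨ Disjoint c A := by
  by_cases h : Disjoint c A
  · exact .inr h
  obtain ⟨a, hac, ha⟩ := Set.not_disjoint_iff.1 h
  refine .inl ⟨a, ha, Set.Subset.antisymm (fun u hu => ?_) (by simpa using hac)⟩
  rw [eq_gComp_of_mem hc hac] at hu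
  induction hu using Relation.ReflTransGen.head_induction_on with
  | refl => rfl
  | head h _ _ => exact absurd ha (gNbr_redirectCG.1 h).2.1

lemma gPaTau_redirectCG_singleton {a : V} (ha : a ∈ A) : gPaTau (redirectCG E A) {a} = ∅ := by
  ext u
  simp [mem_gPaTau, gPar_redirectCG, ha]

lemma IsRank.gPaTau_redirectCG_subset (hr : IsRank E r) {τ c : Set V} (hτ : τ ∈ gComps E)
    (hcτ : c ⊆ τ) : gPaTau (redirectCG E A) c ⊆ gPaTau E τ ∪ τ ∩ A := by
  intro u hu
  obtain ⟨⟨v, hv, huv⟩, -⟩ := mem_gPaTau.1 hu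
  obtain ⟨hvA, he, hor⟩ := gPar_redirectCG.1 huv
  by_cases huτ : u ∈ τ
  · exact .inr ⟨huτ, hor.resolve_left fun h => h (hr.edge_of_mem hτ huτ (hcτ hv) he)⟩
  · refine .inl (mem_gPaTau.2 ⟨⟨v, hcτ hv, he, fun h => huτ ?_⟩, huτ⟩)
    exact mem_of_gNbr hτ (hcτ hv) ⟨h, he⟩

lemma IsRank.mem_of_edge_redirectCG (hr : IsRank E r) {τ c : Set V} (hτ : τ ∈ gComps E)
    (hc : c ∈ gComps (redirectCG E A)) (hcτ : c ⊆ τ) (hcA : Disjoint c A) {u v : V}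
    (hu : u ∈ τ ∪ gPaTau E τ) (hv : v ∈ c) (h : (u, v) ∈ E) :
    u ∈ c ∪ gPaTau (redirectCG E A) c := by
  have hvA := Set.disjoint_left.1 hcA hv
  by_cases huA : u ∈ A
  · refine .inr (mem_gPaTau.2 ⟨⟨v, hv, gPar_redirectCG.2 ⟨hvA, h, .inr huA⟩⟩, fun huc => ?_⟩)
    exact Set.disjoint_left.1 hcA huc huA
  · rcases hu with hu | hu
    · refine .inl (mem_of_gNbr hc hv (gNbr_redirectCG.2 ⟨⟨?_, h⟩, hvA, huA⟩))
      exact hr.edge_of_mem hτ hu (hcτ hv) h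
    · have huτ := (mem_gPaTau.1 hu).2
      refine .inr (mem_gPaTau.2 ⟨⟨v, hv, gPar_redirectCG.2 ⟨hvA, h, .inl fun h' => huτ ?_⟩⟩,
        fun huc => huτ (hcτ huc)⟩)
      exact mem_of_gNbr hτ (hcτ hv) ⟨h', h⟩

/-- A moral clique meeting a chain component `c` of the redirected graph lies in the closure of
`c`, and is a clique of the moral graph there. -/
lemma IsRank.clique_redirectCG (hr : IsRank E r) {τ c K : Set V} (hτ : τ ∈ gComps E)
    (hc : c ∈ gComps (redirectCG E A)) (hcτ : c ⊆ τ) (hcA : Disjoint c A)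
    (hK : IsCliqueIn (moral (gInduced E (τ ∪ gPaTau E τ))) K) (hKc : (K ∩ c).Nonempty) :
    K ⊆ c ∪ gPaTau (redirectCG E A) c ∧ IsCliqueIn (moral (gInduced (redirectCG E A)
      (c ∪ gPaTau (redirectCG E A) c))) K := by
  classical
  have hedge : ∀ u ∈ K, ∀ v ∈ K, v ∈ c → u ≠ v → u ∈ τ ∪ gPaTau E τ ∧ (u, v) ∈ E := by
    intro u hu v hv hvc huv
    have hvpa : v ∉ gPaTau E τ := fun h => (mem_gPaTau.1 h).2 (hcτ hvc)
    rcases (hr.mem_moral_iff hτ huv).1 (hK u hu v hv huv) with h | h | h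
    · exact absurd h.2 hvpa
    · exact ⟨h.1, h.2.2⟩
    · exact ⟨.inl h.2.1, hr.edge_of_mem hτ (hcτ hvc) h.2.1 h.2.2⟩
  have hsub : K ⊆ c ∪ gPaTau (redirectCG E A) c := by
    intro u hu
    obtain ⟨v, hvK, hvc⟩ := hKc
    by_cases huv : u = v
    · exact .inl (huv ▸ hvc)
    · obtain ⟨h1, h2⟩ := hedge u hu v hvK hvc huv
      exact hr.mem_of_edge_redirectCG hτ hc hcτ hcA h1 hvc h2
  refine ⟨hsub, fun u hu v hv huv => ((hr.redirect A).mem_moral_iff hc huv).2 ?_⟩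
  by_cases hvc : v ∈ c
  · exact .inr (.inl ⟨hsub hu, hvc, mem_redirectCG.2
      ⟨(hedge u hu v hv hvc huv).2, Set.disjoint_left.1 hcA hvc⟩⟩)
  · by_cases huc : u ∈ c
    · exact .inr (.inr ⟨hsub hv, huc, mem_redirectCG.2
        ⟨(hedge v hv u hu huc huv.symm).2, Set.disjoint_left.1 hcA huc⟩⟩)
    · exact .inl ⟨(hsub hu).resolve_left huc, (hsub hv).resolve_left hvc⟩

lemma IsRank.clique_of_redirectCG (hr : IsRank E r) {τ c K : Set V} (hτ : τ ∈ gComps E)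
    (hc : c ∈ gComps (redirectCG E A)) (hcτ : c ⊆ τ)
    (hK : IsCliqueIn (moral (gInduced (redirectCG E A)
      (c ∪ gPaTau (redirectCG E A) c))) K) :
    IsCliqueIn (moral (gInduced E (τ ∪ gPaTau E τ))) (K \ A) := by
  classical
  have hpa : ∀ w ∈ gPaTau (redirectCG E A) c, w ∉ A → w ∈ gPaTau E τ := fun w hw hwA =>
    (hr.gPaTau_redirectCG_subset hτ hcτ hw).resolve_right fun h => hwA h.2
  have hcl : ∀ w ∈ c ∪ gPaTau (redirectCG E A) c, w ∉ A → w ∈ τ ∪ gPaTau E τ := by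
    rintro w (hw | hw) hwA
    · exact .inl (hcτ hw)
    · exact .inr (hpa w hw hwA)
  rintro u ⟨hu, huA⟩ v ⟨hv, hvA⟩ huv
  refine (hr.mem_moral_iff hτ huv).2 ?_
  rcases ((hr.redirect A).mem_moral_iff hc huv).1 (hK u hu v hv huv) with h | h | h
  · exact .inl ⟨hpa u h.1 huA, hpa v h.2 hvA⟩
  · exact .inr (.inl ⟨hcl u h.1 huA, hcτ h.2.1, (mem_redirectCG.1 h.2.2).1⟩)
  · exact .inr (.inr ⟨hcl v h.1 hvA, hcτ h.2.1, (mem_redirectCG.1 h.2.2).1⟩)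

lemma diff_union_given (E : Set (V × V)) (A τ : Set V) :
    τ \ A ∪ (gPaTau E τ ∪ (τ ∩ A)) = τ ∪ gPaTau E τ := by
  ext v
  simp only [Set.mem_union, Set.mem_sdiff, Set.mem_inter_iff]
  tauto

lemma given_subset (E : Set (V × V)) (A τ : Set V) :
    gPaTau E τ ∪ (τ ∩ A) ⊆ τ ∪ gPaTau E τ := by
  rw [← diff_union_given E A τ]
  exact Set.subset_union_right

lemma given_subset_compl (E : Set (V × V)) (A τ : Set V) :
    gPaTau E τ ∪ (τ ∩ A) ⊆ (τ \ A)ᶜ := by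
  rintro v (hv | hv) h
  · exact (mem_gPaTau.1 hv).2 h.1
  · exact h.2 hv.2

/-- The finite set of chain components. -/
noncomputable def compFinset [Finite V] (E : Set (V × V)) : Finset (Set V) :=
  (Set.toFinite (gComps E)).toFinset

lemma mem_compFinset [Finite V] {τ : Set V} : τ ∈ compFinset E ↔ τ ∈ gComps E := by
  simp [compFinset]

lemma biUnion_compFinset [Finite V] (E : Set (V × V)) : (⋃ c ∈ compFinset E, c) = Set.univ := by
  ext v
  simp only [Set.mem_iUnion, Set.mem_univ, iff_true]
  exact ⟨_, mem_compFinset.2 (gComp_mem_gComps v), mem_gComp_self v⟩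

end Graph

end BH

namespace BH

open scoped Classical

section DependsOn

variable {V : Type*} {X : V → Type*}

lemma DependsOn.mono {F : (∀ v, X v) → ℝ} {S T : Set V} (h : DependsOn F S) (hST : S ⊆ T) :
    DependsOn F T :=
  fun x y hxy => h x y fun v hv => hxy v (hST hv)

lemma DependsOn.mul {F G : (∀ v, X v) → ℝ} {S : Set V} (hF : DependsOn F S)
    (hG : DependsOn G S) : DependsOn (fun x => F x * G x) S :=
  fun x y h => by simp only [hF x y h, hG x y h]

lemma DependsOn.div {F G : (∀ v, X v) → ℝ} {S : Set V} (hF : DependsOn F S)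
    (hG : DependsOn G S) : DependsOn (fun x => F x / G x) S :=
  fun x y h => by simp only [hF x y h, hG x y h]

lemma DependsOn.prod {ι : Type*} {s : Finset ι} {F : ι → (∀ v, X v) → ℝ} {S : Set V}
    (hF : ∀ i ∈ s, DependsOn (F i) S) : DependsOn (fun x => ∏ i ∈ s, F i x) S :=
  fun x y h => Finset.prod_congr rfl fun i hi => hF i hi x y h

lemma dependsOn_univ (F : (∀ v, X v) → ℝ) : DependsOn F Set.univ := by
  intro x y h
  rw [funext fun v => h v (Set.mem_univ v)]

lemma dependsOn_compl_biUnion {F : (∀ v, X v) → ℝ} {s : Finset (Set V)}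
    (h : ∀ c ∈ s, DependsOn F cᶜ) : DependsOn F (⋃ c ∈ s, c)ᶜ := by
  induction s using Finset.induction_on with
  | empty => exact fun y z hyz => dependsOn_univ F y z fun v _ => hyz v (by simp)
  | insert b t hb ih =>
    intro y z hyz
    rw [h b (by simp) y (b.piecewise z y)
      (fun v hv => by simp only [Set.mem_compl_iff] at hv; simp [hv])]
    refine ih (fun c hc => h c (by simp [hc])) _ _ fun v hv => ?_
    by_cases hvb : v ∈ b
    · simp [hvb]
    · simp only [hvb, not_false_eq_true, Set.piecewise_eq_of_notMem]
      exact hyz v (by simpa [hvb] using hv)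

/-- The configuration `x` with the coordinates outside `D` replaced by those of `b`. -/
noncomputable def restrictTo (D : Set V) (b x : ∀ v, X v) : ∀ v, X v := D.piecewise x b

lemma restrictTo_of_mem {D : Set V} {v : V} (h : v ∈ D) (b x : ∀ v, X v) :
    restrictTo D b x v = x v := by
  simp [restrictTo, h]

lemma restrictTo_of_notMem {D : Set V} {v : V} (h : v ∉ D) (b x : ∀ v, X v) :
    restrictTo D b x v = b v := by
  simp [restrictTo, h]

lemma DependsOn.comp_restrictTo {K : Set V} {g : (∀ v, X v) → ℝ} (hg : DependsOn g K)
    (D : Set V) (b : ∀ v, X v) : DependsOn (fun x => g (restrictTo D b x)) (K ∩ D) := by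
  refine fun x y h => hg _ _ fun v hv => ?_
  by_cases hvD : v ∈ D
  · simp [restrictTo, hvD, h v ⟨hv, hvD⟩]
  · simp [restrictTo, hvD]

end DependsOn

section Sums

variable {V : Type*} [Fintype V] [DecidableEq V] {X : V → Type*} [∀ v, Fintype (X v)]

lemma sumOver_eq (S : Set V) (F : (∀ v, X v) → ℝ) (x : ∀ v, X v) :
    sumOver S F x = ∑ y with (∀ v, v ∉ S → y v = x v), F y := by
  simp [sumOver, Set.indicator_apply, Finset.sum_filter]

lemma marginal_eq_sumOver (p : (∀ v, X v) → ℝ) (S : Set V) :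
    marginal p S = sumOver Sᶜ p := by
  ext x
  simp [marginal, sumOver]

lemma sumOver_congr_of_forall {S : Set V} {F G : (∀ v, X v) → ℝ} {x x' : ∀ v, X v}
    (h : ∀ y y', (∀ v, v ∉ S → y v = x v) → (∀ v, v ∉ S → y' v = x' v) →
      (∀ v ∈ S, y v = y' v) → F y = G y') :
    sumOver S F x = sumOver S G x' := by
  rw [sumOver_eq, sumOver_eq]
  refine Finset.sum_nbij' (fun y => S.piecewise y x') (fun y => S.piecewise y x) ?_ ?_ ?_ ?_ ?_
  · intro y hy
    simp +contextual
  · intro y hy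
    simp +contextual
  · intro y hy
    simp only [Finset.mem_filter, Finset.mem_univ, true_and] at hy
    ext v
    by_cases hv : v ∈ S <;> simp [hv, hy]
  · intro y hy
    simp only [Finset.mem_filter, Finset.mem_univ, true_and] at hy
    ext v
    by_cases hv : v ∈ S <;> simp [hv, hy]
  · intro y hy
    simp only [Finset.mem_filter, Finset.mem_univ, true_and] at hy
    exact h _ _ hy (by simp +contextual) (by simp +contextual)

lemma DependsOn.sumOver {F : (∀ v, X v) → ℝ} {D : Set V} (h : DependsOn F D) (S : Set V) :
    DependsOn (sumOver S F) (D \ S) := by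
  intro x x' hx
  refine sumOver_congr_of_forall fun y y' hy hy' hyy => h _ _ fun v hv => ?_
  by_cases hvS : v ∈ S
  · exact hyy v hvS
  · rw [hy v hvS, hy' v hvS, hx v ⟨hv, hvS⟩]

lemma dependsOn_marginal (p : (∀ v, X v) → ℝ) (S : Set V) : DependsOn (marginal p S) S := by
  rw [marginal_eq_sumOver]
  exact ((dependsOn_univ p).sumOver _).mono (by simp)

lemma sumOver_mul_left {S : Set V} {F : (∀ v, X v) → ℝ} (hF : DependsOn F Sᶜ)
    (G : (∀ v, X v) → ℝ) (x : ∀ v, X v) :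
    sumOver S (fun y => F y * G y) x = F x * sumOver S G x := by
  rw [sumOver_eq, sumOver_eq, Finset.mul_sum]
  refine Finset.sum_congr rfl fun y hy => ?_
  simp only [Finset.mem_filter, Finset.mem_univ, true_and] at hy
  rw [hF y x fun v hv => hy v hv]

lemma sumOver_mono {S : Set V} {F G : (∀ v, X v) → ℝ} (h : ∀ y, F y ≤ G y) (x : ∀ v, X v) :
    sumOver S F x ≤ sumOver S G x := by
  rw [sumOver_eq, sumOver_eq]
  exact Finset.sum_le_sum fun y _ => h y

lemma sumOver_nonneg {S : Set V} {F : (∀ v, X v) → ℝ} (h : ∀ y, 0 ≤ F y) (x : ∀ v, X v) :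
    0 ≤ sumOver S F x := by
  rw [sumOver_eq]
  exact Finset.sum_nonneg fun y _ => h y

lemma le_sumOver {S : Set V} {F : (∀ v, X v) → ℝ} (h : ∀ y, 0 ≤ F y) (x : ∀ v, X v) :
    F x ≤ sumOver S F x := by
  rw [sumOver_eq]
  exact Finset.single_le_sum (fun y _ => h y) (by simp)

lemma exists_ne_zero_of_sumOver_ne_zero {S : Set V} {F : (∀ v, X v) → ℝ} {x : ∀ v, X v}
    (h : sumOver S F x ≠ 0) : ∃ y, (∀ v, v ∉ S → y v = x v) ∧ F y ≠ 0 := by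
  rw [sumOver_eq] at h
  obtain ⟨y, hy, hF⟩ := Finset.exists_ne_zero_of_sum_ne_zero h
  exact ⟨y, by simpa using hy, hF⟩

lemma sumOver_univ (F : (∀ v, X v) → ℝ) (x : ∀ v, X v) : sumOver Set.univ F x = ∑ y, F y := by
  simp [sumOver_eq]

lemma sumOver_empty (F : (∀ v, X v) → ℝ) (x : ∀ v, X v) : sumOver ∅ F x = F x := by
  rw [sumOver_eq, Finset.sum_eq_single x]
  · intro y hy hne
    simp only [Finset.mem_filter, Finset.mem_univ, true_and] at hy
    exact absurd (funext fun v => hy v (by simp)) hne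
  · simp

lemma sumOver_union {S T : Set V} (hST : Disjoint S T) (F : (∀ v, X v) → ℝ) (x : ∀ v, X v) :
    sumOver (S ∪ T) F x = sumOver S (sumOver T F) x := by
  have hdisj : ∀ v, v ∈ S → v ∉ T := fun v hS hT => Set.disjoint_left.1 hST hS hT
  have : ∀ z, sumOver T F z = ∑ y, if (∀ v, v ∉ T → y v = z v) then F y else 0 := fun z => by
    rw [sumOver_eq, Finset.sum_filter]
  rw [sumOver_eq S]
  simp only [this]
  rw [Finset.sum_comm, sumOver_eq, Finset.sum_filter]
  refine Finset.sum_congr rfl fun y _ => ?_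
  rw [Finset.sum_filter, Finset.sum_eq_single (T.piecewise x y)]
  · have h1 : (∀ v, v ∉ S → T.piecewise x y v = x v) ↔ ∀ v, v ∉ S ∪ T → y v = x v := by
      refine forall_congr' fun v => ?_
      by_cases hT : v ∈ T
      · simp [hT]
      · simp [hT]
    have h2 : ∀ v, v ∉ T → y v = T.piecewise x y v := by simp +contextual
    simp only [h1, if_pos h2]
    congr
  · intro z _ hz
    by_contra hcon
    simp only [ite_eq_right_iff, Classical.not_imp] at hcon
    obtain ⟨h1, h2, -⟩ := hcon
    refine hz (funext fun v => ?_)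
    by_cases hT : v ∈ T
    · simp [hT, h1 v fun hS => hdisj v hS hT]
    · simp [hT, h2 v hT]
  · simp

lemma marginal_eq_sumOver_marginal (p : (∀ v, X v) → ℝ) {S T : Set V} (h : S ⊆ T) :
    marginal p S = sumOver (T \ S) (marginal p T) := by
  ext x
  rw [marginal_eq_sumOver, marginal_eq_sumOver, ← sumOver_union]
  · congr 1
    ext v
    have := @h v
    simp only [Set.mem_compl_iff, Set.mem_union, Set.mem_sdiff]
    tauto
  · exact Set.disjoint_left.2 fun v hv hv' => hv' hv.1

lemma marginal_nonneg {p : (∀ v, X v) → ℝ} (hp : ∀ x, 0 ≤ p x) (S : Set V) (x : ∀ v, X v) :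
    0 ≤ marginal p S x := by
  rw [marginal_eq_sumOver]
  exact sumOver_nonneg hp x

lemma le_marginal {p : (∀ v, X v) → ℝ} (hp : ∀ x, 0 ≤ p x) (S : Set V) (x : ∀ v, X v) :
    p x ≤ marginal p S x := by
  rw [marginal_eq_sumOver]
  exact le_sumOver hp x

lemma marginal_anti {p : (∀ v, X v) → ℝ} (hp : ∀ x, 0 ≤ p x) {S T : Set V} (h : S ⊆ T)
    (x : ∀ v, X v) : marginal p T x ≤ marginal p S x := by
  rw [marginal_eq_sumOver_marginal p h]
  exact le_sumOver (marginal_nonneg hp T) x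

lemma marginal_ne_zero_of_subset {p : (∀ v, X v) → ℝ} (hp : ∀ x, 0 ≤ p x) {S T : Set V}
    (h : S ⊆ T) {x : ∀ v, X v} (hx : marginal p T x ≠ 0) : marginal p S x ≠ 0 :=
  (((marginal_nonneg hp T x).lt_of_ne' hx).trans_le (marginal_anti hp h x)).ne'

lemma marginal_ne_zero_of_ne_zero {p : (∀ v, X v) → ℝ} (hp : ∀ x, 0 ≤ p x) (S : Set V)
    {x : ∀ v, X v} (hx : p x ≠ 0) : marginal p S x ≠ 0 :=
  (((hp x).lt_of_ne' hx).trans_le (le_marginal hp S x)).ne'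

lemma ConsistentWith.eq_of_marginal_ne_zero {p : (∀ v, X v) → ℝ} {A : Set V} {a0 : ∀ v, X v}
    (h : ConsistentWith p A a0) {S : Set V} {x : ∀ v, X v} (hx : marginal p S x ≠ 0) :
    ∀ v ∈ S ∩ A, x v = a0 v := by
  rw [marginal_eq_sumOver] at hx
  obtain ⟨y, hy, hpy⟩ := exists_ne_zero_of_sumOver_ne_zero hx
  rintro v ⟨hvS, hvA⟩
  rw [← hy v (by simpa using hvS), h y hpy v hvA]

lemma sumOver_biUnion_prod (C : Finset (Set V)) (g : Set V → (∀ v, X v) → ℝ)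
    (hdisj : ∀ c ∈ C, ∀ c' ∈ C, c ≠ c' → Disjoint c c')
    (hg : ∀ c ∈ C, ∀ c' ∈ C, c ≠ c' → DependsOn (g c) c'ᶜ) (x : ∀ v, X v) :
    sumOver (⋃ c ∈ C, c) (fun y => ∏ c ∈ C, g c y) x = ∏ c ∈ C, sumOver c (g c) x := by
  induction C using Finset.induction_on generalizing x with
  | empty => simp [sumOver_empty]
  | insert a s ha ih =>
    have hne : ∀ c ∈ s, a ≠ c := fun c hc h => ha (h ▸ hc)
    have hd : Disjoint a (⋃ c ∈ s, c) := by
      simp only [Set.disjoint_iUnion_right]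
      exact fun c hc => hdisj a (by simp) c (by simp [hc]) (hne c hc)
    have hga : DependsOn (g a) (⋃ c ∈ s, c)ᶜ :=
      dependsOn_compl_biUnion fun c hc => hg a (by simp) c (by simp [hc]) (hne c hc)
    have hps : DependsOn (fun y => ∏ c ∈ s, sumOver c (g c) y) aᶜ := by
      refine DependsOn.prod fun c hc => ?_
      exact ((hg c (by simp [hc]) a (by simp) (hne c hc).symm).sumOver c).mono Set.sdiff_subset
    simp only [Finset.set_biUnion_insert, Finset.prod_insert ha]
    rw [sumOver_union hd]
    have : sumOver (⋃ c ∈ s, c) (fun y => g a y * ∏ c ∈ s, g c y)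
        = fun y => (∏ c ∈ s, sumOver c (g c) y) * g a y := by
      ext y
      rw [sumOver_mul_left hga, ih, mul_comm]
      · exact fun c hc c' hc' => hdisj c (by simp [hc]) c' (by simp [hc'])
      · exact fun c hc c' hc' => hg c (by simp [hc]) c' (by simp [hc'])
    rw [this, sumOver_mul_left hps, mul_comm]

lemma sumOver_biUnion_prod_le_one (C : Finset (Set V)) (k : Set V → (∀ v, X v) → ℝ)
    (ρ : Set V → ℕ)
    (hdisj : ∀ c ∈ C, ∀ c' ∈ C, c ≠ c' → Disjoint c c')
    (hk : ∀ c ∈ C, ∀ c' ∈ C, c ≠ c' → ρ c ≤ ρ c' → DependsOn (k c) c'ᶜ)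
    (hk0 : ∀ c ∈ C, ∀ x, 0 ≤ k c x) (hk1 : ∀ c ∈ C, ∀ x, sumOver c (k c) x ≤ 1)
    (x : ∀ v, X v) :
    sumOver (⋃ c ∈ C, c) (fun y => ∏ c ∈ C, k c y) x ≤ 1 := by
  induction C using Finset.induction_on_max_value ρ generalizing x with
  | empty => simp [sumOver_empty]
  | insert a s ha hmax ih =>
    have hne : ∀ c ∈ s, a ≠ c := fun c hc h => ha (h ▸ hc)
    have hd : Disjoint (⋃ c ∈ s, c) a := by
      simp only [Set.disjoint_iUnion_left]
      exact fun c hc => hdisj c (by simp [hc]) a (by simp) (hne c hc).symm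
    have hps : DependsOn (fun y => ∏ c ∈ s, k c y) aᶜ :=
      DependsOn.prod fun c hc => hk c (by simp [hc]) a (by simp) (hne c hc).symm (hmax c hc)
    simp only [Finset.set_biUnion_insert, Finset.prod_insert ha]
    rw [Set.union_comm, sumOver_union hd]
    refine (sumOver_mono (G := fun y => ∏ c ∈ s, k c y) (fun y => ?_) x).trans
      (ih (fun c hc c' hc' => hdisj c (by simp [hc]) c' (by simp [hc']))
        (fun c hc c' hc' => hk c (by simp [hc]) c' (by simp [hc']))
        (fun c hc => hk0 c (by simp [hc])) (fun c hc => hk1 c (by simp [hc])) x)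
    have : (fun y => k a y * ∏ c ∈ s, k c y) = fun y => (∏ c ∈ s, k c y) * k a y := by
      ext y
      rw [mul_comm]
    rw [this, sumOver_mul_left hps]
    exact mul_le_of_le_one_right (Finset.prod_nonneg fun c hc => hk0 c (by simp [hc]) y)
      (hk1 a (by simp) y)

lemma sumOver_indicator_eq (B : Set V) (a0 x : ∀ v, X v) :
    sumOver B (fun y => if ∀ v ∈ B, y v = a0 v then (1 : ℝ) else 0) x = 1 := by
  rw [sumOver_eq, Finset.sum_eq_single (B.piecewise a0 x)]
  · exact if_pos fun v hv => by simp [hv]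
  · intro y hy hne
    simp only [Finset.mem_filter, Finset.mem_univ, true_and] at hy
    rw [if_neg]
    refine fun h => hne (funext fun v => ?_)
    by_cases hv : v ∈ B <;> simp [hv, h, hy]
  · intro h
    refine absurd ?_ h
    simp only [Finset.mem_filter, Finset.mem_univ, true_and]
    exact fun v hv => by simp [hv]

end Sums

section CliqueFac

variable {V : Type*} {X : V → Type*} {U : Set (V × V)}

/-- `g` is a product of nonnegative functions, one for each maximal clique `K` of `U`, depending
only on the coordinates in `K`. -/
def CliqueFac (U : Set (V × V)) (g : (∀ v, X v) → ℝ) : Prop :=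
  ∃ ψ : Set V → (∀ v, X v) → ℝ,
    (∀ K ∈ maxCliques U, (∀ x, 0 ≤ ψ K x) ∧ DependsOn (ψ K) K) ∧
    ∀ x, g x = ∏ᶠ K ∈ maxCliques U, ψ K x

lemma cliqueFac_one : CliqueFac U (fun _ : (∀ v, X v) => (1 : ℝ)) :=
  ⟨fun _ _ => 1, fun _ _ => ⟨fun _ => zero_le_one, fun _ _ _ => rfl⟩, fun _ => by simp⟩

variable [Finite V]

/-- The finite set of maximal cliques. -/
noncomputable def maxCliqueFinset (U : Set (V × V)) : Finset (Set V) :=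
  (Set.toFinite (maxCliques U)).toFinset

lemma mem_maxCliqueFinset {K : Set V} : K ∈ maxCliqueFinset U ↔ K ∈ maxCliques U := by
  simp [maxCliqueFinset]

lemma finprod_maxCliques (F : Set V → ℝ) :
    ∏ᶠ K ∈ maxCliques U, F K = ∏ K ∈ maxCliqueFinset U, F K :=
  finprod_mem_eq_finite_toFinset_prod _ _

lemma CliqueFac.mul {g h : (∀ v, X v) → ℝ} (hg : CliqueFac U g) (hh : CliqueFac U h) :
    CliqueFac U (fun x => g x * h x) := by
  obtain ⟨ψ, hψ, hgψ⟩ := hg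
  obtain ⟨φ, hφ, hhφ⟩ := hh
  refine ⟨fun K x => ψ K x * φ K x, fun K hK => ⟨fun x => ?_, ?_⟩, fun x => ?_⟩
  · exact mul_nonneg ((hψ K hK).1 x) ((hφ K hK).1 x)
  · exact (hψ K hK).2.mul (hφ K hK).2
  · dsimp only
    rw [hgψ, hhφ]
    exact (finprod_mem_mul_distrib (Set.toFinite _)).symm

lemma CliqueFac.prod {ι : Type*} {s : Finset ι} {g : ι → (∀ v, X v) → ℝ}
    (hg : ∀ i ∈ s, CliqueFac U (g i)) : CliqueFac U (fun x => ∏ i ∈ s, g i x) := by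
  induction s using Finset.induction_on with
  | empty => simpa using cliqueFac_one
  | insert a s ha ih =>
    simp only [Finset.prod_insert ha]
    exact (hg a (by simp)).mul (ih fun i hi => hg i (by simp [hi]))

lemma exists_maxClique_of_isCliqueIn [Nonempty V] {K : Set V} (hK : IsCliqueIn U K) :
    ∃ M ∈ maxCliques U, K ⊆ M := by
  have key : ∀ K : Set V, K.Nonempty → IsCliqueIn U K → ∃ M ∈ maxCliques U, K ⊆ M := by
    intro K hne hK
    obtain ⟨M, hKM, hM⟩ := (Set.toFinite {L | IsCliqueIn U L}).exists_le_maximal hK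
    exact ⟨M, ⟨hne.mono hKM, Set.subset_univ _, hM.prop, fun L hL _ hLc =>
      (hM.le_of_ge hLc hL).antisymm hL⟩, hKM⟩
  rcases K.eq_empty_or_nonempty with rfl | hne
  · obtain ⟨v⟩ := ‹Nonempty V›
    obtain ⟨M, hM, -⟩ := key {v} (Set.singleton_nonempty v)
      (fun a ha b hb hab => absurd (ha.trans hb.symm) hab)
    exact ⟨M, hM, Set.empty_subset _⟩
  · exact key K hne hK

lemma cliqueFac_of_isCliqueIn [Nonempty V] {K : Set V} (hK : IsCliqueIn U K)
    {g : (∀ v, X v) → ℝ} (h0 : ∀ x, 0 ≤ g x) (hg : DependsOn g K) : CliqueFac U g := by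
  obtain ⟨M, hM, hKM⟩ := exists_maxClique_of_isCliqueIn hK
  refine ⟨fun L x => if L = M then g x else 1, fun L _ => ⟨fun x => ?_, ?_⟩, fun x => ?_⟩
  · dsimp only
    split_ifs
    exacts [h0 x, zero_le_one]
  · by_cases h : L = M
    · simpa [h] using hg.mono hKM
    · simp [h, DependsOn]
  · rw [finprod_maxCliques, Finset.prod_ite_eq', if_pos (mem_maxCliqueFinset.2 hM)]

end CliqueFac

section Kernel

variable {V : Type*} [Fintype V] [DecidableEq V] {X : V → Type*} [∀ v, Fintype (X v)]
  {E : Set (V × V)} {A : Set V} {r : V → ℕ} {a0 : ∀ v, X v} {f : (∀ v, X v) → ℝ}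

/-- The conditional pmf attached to the chain component `τ` in the factorization of `f`. -/
noncomputable def kern (E : Set (V × V)) (A : Set V) (f : (∀ v, X v) → ℝ) (τ : Set V)
    (x : ∀ v, X v) : ℝ :=
  condM f (τ \ A) (gPaTau E τ ∪ (τ ∩ A)) x

lemma kern_eq (E : Set (V × V)) (A : Set V) (f : (∀ v, X v) → ℝ) (τ : Set V) (x : ∀ v, X v) :
    kern E A f τ x
      = marginal f (τ ∪ gPaTau E τ) x / marginal f (gPaTau E τ ∪ (τ ∩ A)) x := by
  rw [kern, condM, diff_union_given]

lemma dependsOn_kern (E : Set (V × V)) (A : Set V) (f : (∀ v, X v) → ℝ) (τ : Set V) :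
    DependsOn (kern E A f τ) (τ ∪ gPaTau E τ) := by
  intro x y h
  rw [kern_eq, kern_eq, dependsOn_marginal f _ x y h,
    (dependsOn_marginal f _).mono (given_subset E A τ) x y h]

lemma kern_nonneg (hf : ∀ x, 0 ≤ f x) (τ : Set V) (x : ∀ v, X v) : 0 ≤ kern E A f τ x :=
  div_nonneg (marginal_nonneg hf _ x) (marginal_nonneg hf _ x)

lemma marginal_eq_mul_kern (hf : ∀ x, 0 ≤ f x) (τ : Set V) (x : ∀ v, X v) :
    marginal f (τ ∪ gPaTau E τ) x
      = marginal f (gPaTau E τ ∪ (τ ∩ A)) x * kern E A f τ x := by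
  rw [kern_eq]
  by_cases h : marginal f (gPaTau E τ ∪ (τ ∩ A)) x = 0
  · rw [h, zero_mul]
    by_contra hne
    exact marginal_ne_zero_of_subset hf (given_subset E A τ) hne h
  · field_simp

lemma kern_ne_zero (hf : ∀ x, 0 ≤ f x) (τ : Set V) {x : ∀ v, X v} (hx : f x ≠ 0) :
    kern E A f τ x ≠ 0 := by
  rw [kern_eq]
  exact div_ne_zero (marginal_ne_zero_of_ne_zero hf _ hx) (marginal_ne_zero_of_ne_zero hf _ hx)

lemma sumOver_marginal_eq (E : Set (V × V)) (A τ : Set V) :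
    sumOver (τ \ A) (marginal f (τ ∪ gPaTau E τ)) = marginal f (gPaTau E τ ∪ (τ ∩ A)) := by
  rw [marginal_eq_sumOver_marginal f (given_subset E A τ)]
  congr 1
  ext v
  have : v ∈ gPaTau E τ → v ∉ τ := fun h => (mem_gPaTau.1 h).2
  simp only [Set.mem_union, Set.mem_sdiff, Set.mem_inter_iff]
  tauto

lemma sumOver_diff_kern_le (hcons : ConsistentWith f A a0) (τ : Set V)
    (x : ∀ v, X v) :
    sumOver (τ \ A) (kern E A f τ) x ≤ if ∀ v ∈ τ ∩ A, x v = a0 v then 1 else 0 := by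
  have hk : kern E A f τ = fun y => (marginal f (gPaTau E τ ∪ (τ ∩ A)) y)⁻¹
      * marginal f (τ ∪ gPaTau E τ) y := by
    ext y
    rw [kern_eq, div_eq_inv_mul]
  have hdep : DependsOn (fun y => (marginal f (gPaTau E τ ∪ (τ ∩ A)) y)⁻¹) (τ \ A)ᶜ := by
    intro y z h
    dsimp only
    rw [(dependsOn_marginal f _).mono (given_subset_compl E A τ) y z h]
  rw [hk, sumOver_mul_left hdep, sumOver_marginal_eq]
  by_cases h : marginal f (gPaTau E τ ∪ (τ ∩ A)) x = 0
  · rw [h, mul_zero]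
    split_ifs <;> simp
  · rw [inv_mul_cancel₀ h, if_pos]
    exact fun v hv => hcons.eq_of_marginal_ne_zero h v ⟨.inr hv, hv.2⟩

lemma sumOver_kern_le_one (hcons : ConsistentWith f A a0) (τ : Set V)
    (x : ∀ v, X v) : sumOver τ (kern E A f τ) x ≤ 1 := by
  have : τ = τ ∩ A ∪ τ \ A := (Set.inter_union_sdiff τ A).symm
  conv_lhs => arg 1; rw [this]
  rw [sumOver_union (Set.disjoint_sdiff_inter.symm)]
  refine (sumOver_mono (sumOver_diff_kern_le hcons τ) x).trans_eq ?_
  convert sumOver_indicator_eq (τ ∩ A) a0 x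

lemma sumOver_prod_kern_le_one (hr : IsRank E r) (hf : ∀ x, 0 ≤ f x)
    (hcons : ConsistentWith f A a0) {C : Finset (Set V)} (hC : C ⊆ compFinset E)
    (x : ∀ v, X v) :
    sumOver (⋃ c ∈ C, c) (fun y => ∏ c ∈ C, kern E A f c y) x ≤ 1 := by
  have hmem : ∀ c ∈ C, c ∈ gComps E := fun c hc => mem_compFinset.1 (hC hc)
  let ρ : Set V → ℕ := fun c => if h : c.Nonempty then r h.some else 0
  have hρ : ∀ c ∈ C, ∀ v ∈ c, ρ c = r v := by
    intro c hc v hv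
    have hne : c.Nonempty := ⟨v, hv⟩
    simp only [ρ, dif_pos hne]
    exact hr.eq_of_mem (hmem c hc) hne.some_mem hv
  refine sumOver_biUnion_prod_le_one C _ ρ
    (fun c hc c' hc' h => gComps_disjoint (hmem c hc) (hmem c' hc') h)
    (fun c hc c' hc' hne hle => (dependsOn_kern E A f c).mono ?_)
    (fun c _ => kern_nonneg hf c) (fun c _ => sumOver_kern_le_one hcons c) x
  rintro v (hv | hv) hv'
  · exact hne (gComps_eq_of_mem (hmem c hc) (hmem c' hc') hv hv')
  · obtain ⟨w, hw⟩ := gComps_nonempty (hmem c hc)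
    have := hr.lt_of_mem_gPaTau (hmem c hc) hv hw
    rw [hρ c hc w hw, hρ c' hc' v hv'] at hle
    omega

/-- For a pmf it is enough to check the product formula on the support. -/
lemma eq_prod_kern_of_ne_zero (hr : IsRank E r) (hf : IsPMF f) (hcons : ConsistentWith f A a0)
    (h : ∀ x, f x ≠ 0 → f x = ∏ c ∈ compFinset E, kern E A f c x) (x : ∀ v, X v) :
    f x = ∏ c ∈ compFinset E, kern E A f c x := by
  have hle : ∀ y ∈ Finset.univ, f y ≤ ∏ c ∈ compFinset E, kern E A f c y := by
    intro y _
    by_cases hy : f y = 0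
    · rw [hy]
      exact Finset.prod_nonneg fun c _ => kern_nonneg hf.1 c y
    · exact (h y hy).le
  have hsum := sumOver_prod_kern_le_one hr hf.1 hcons (Finset.Subset.refl (compFinset E)) x
  rw [biUnion_compFinset, sumOver_univ, ← hf.2] at hsum
  exact (Finset.sum_eq_sum_iff_of_le hle).1 (le_antisymm (Finset.sum_le_sum hle) hsum) x
    (Finset.mem_univ x)

/-- The marginal on a union of chain components closed under parents is the product of the
kernels of these components. -/
lemma marginal_biUnion_eq_prod_kern (hr : IsRank E r) (hf : IsPMF f)
    (hcons : ConsistentWith f A a0) (h : ∀ x, f x = ∏ c ∈ compFinset E, kern E A f c x)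
    {C : Finset (Set V)} (hC : C ⊆ compFinset E)
    (hpa : ∀ c ∈ C, gPaTau E c ⊆ ⋃ c ∈ C, c) (x : ∀ v, X v) :
    marginal f (⋃ c ∈ C, c) x = ∏ c ∈ C, kern E A f c x := by
  set S : Set V := ⋃ c ∈ C, c with hS
  have hSc : Sᶜ = ⋃ c ∈ compFinset E \ C, c := by
    ext v
    simp only [hS, Set.mem_compl_iff, Set.mem_iUnion, Finset.mem_sdiff, not_exists, exists_prop]
    constructor
    · intro hv
      refine ⟨gComp E v, ⟨mem_compFinset.2 (gComp_mem_gComps v), fun hmem => ?_⟩,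
        mem_gComp_self v⟩
      exact hv _ ⟨hmem, mem_gComp_self v⟩
    · rintro ⟨c, ⟨hc, hcC⟩, hv⟩ c' ⟨hc', hv'⟩
      exact hcC (gComps_eq_of_mem (mem_compFinset.1 hc) (mem_compFinset.1 (hC hc')) hv hv' ▸ hc')
  have hdep : DependsOn (fun y => ∏ c ∈ C, kern E A f c y) S := by
    refine DependsOn.prod fun c hc => (dependsOn_kern E A f c).mono ?_
    exact Set.union_subset (Set.subset_biUnion_of_mem (u := fun c => c) hc) (hpa c hc)
  have hle : ∀ y, marginal f S y ≤ ∏ c ∈ C, kern E A f c y := by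
    intro y
    have hfun : f = fun y => (∏ c ∈ C, kern E A f c y)
        * ∏ c ∈ compFinset E \ C, kern E A f c y := by
      ext y
      rw [mul_comm, Finset.prod_sdiff hC, ← h]
    have hprod := sumOver_mul_left (S := Sᶜ) (F := fun y => ∏ c ∈ C, kern E A f c y)
      (hdep.mono (by simp)) (fun y => ∏ c ∈ compFinset E \ C, kern E A f c y) y
    rw [marginal_eq_sumOver]
    conv_lhs => arg 2; rw [hfun]
    rw [hprod, hSc]
    exact mul_le_of_le_one_right (Finset.prod_nonneg fun c _ => kern_nonneg hf.1 c y)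
      (sumOver_prod_kern_le_one hr hf.1 hcons Finset.sdiff_subset y)
  have hone : sumOver S (marginal f S) x = 1 := by
    rw [marginal_eq_sumOver, ← sumOver_union disjoint_compl_right, Set.union_compl_self,
      sumOver_univ, hf.2]
  have hsum := sumOver_prod_kern_le_one hr hf.1 hcons hC x
  rw [← hone, sumOver_eq, sumOver_eq] at hsum
  refine (Finset.sum_eq_sum_iff_of_le fun y _ => hle y).1
    (le_antisymm (Finset.sum_le_sum fun y _ => hle y) hsum) x ?_
  simp

lemma ConsistentWith.marginal_union (hcons : ConsistentWith f A a0) (S : Set V) {B : Set V}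
    (hB : B ⊆ A) {x : ∀ v, X v} (hx : ∀ v ∈ B, x v = a0 v) :
    marginal f (S ∪ B) x = marginal f S x := by
  refine Finset.sum_congr rfl fun y _ => ?_
  by_cases hy : f y = 0
  · simp [Set.indicator_apply, hy]
  · have : (∀ v ∈ S ∪ B, y v = x v) ↔ ∀ v ∈ S, y v = x v := by
      refine ⟨fun h v hv => h v (.inl hv), fun h v hv => hv.elim (h v) fun hvB => ?_⟩
      rw [hx v hvB, hcons y hy v (hB hvB)]
    simp only [Set.indicator_apply, Set.mem_ofPred_eq, this]

lemma cliqueFac_indicator_marginal (hr : IsRank E r)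
    (hcons : ConsistentWith f A a0) {τ : Set V} (hτ : τ ∈ gComps E) :
    CliqueFac (moral (gInduced E (τ ∪ gPaTau E τ)))
      (fun x => if marginal f (gPaTau E τ ∪ (τ ∩ A)) x = 0 then 0 else 1) := by
  obtain ⟨w, -⟩ := gComps_nonempty hτ
  have : Nonempty V := ⟨w⟩
  have h1 : CliqueFac (moral (gInduced E (τ ∪ gPaTau E τ)))
      (fun x => if marginal f (gPaTau E τ) x = 0 then 0 else 1) := by
    refine cliqueFac_of_isCliqueIn (K := gPaTau E τ)
      (fun u hu v hv huv => (hr.mem_moral_iff hτ huv).2 (.inl ⟨hu, hv⟩))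
      (fun x => by split_ifs <;> simp) fun x y h => ?_
    simp only [dependsOn_marginal f _ x y h]
  have h2 : CliqueFac (moral (gInduced E (τ ∪ gPaTau E τ)))
      (fun x => ∏ a ∈ (τ ∩ A).toFinset, if x a = a0 a then 1 else 0) := by
    refine CliqueFac.prod fun a _ => cliqueFac_of_isCliqueIn (K := {a})
      (fun u hu v hv huv => absurd (hu.trans hv.symm) huv)
      (fun x => by split_ifs <;> simp) fun x y h => ?_
    simp only [h a rfl]
  convert h1.mul h2 using 2 with x
  rw [Finset.prod_ite_zero]
  simp only [Set.mem_toFinset, Finset.prod_const_one]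
  by_cases hx : ∀ a ∈ τ ∩ A, x a = a0 a
  · rw [if_pos hx, mul_one, hcons.marginal_union _ Set.inter_subset_right hx]
  · rw [if_neg hx, mul_zero, if_pos]
    by_contra hne
    exact hx fun a ha => hcons.eq_of_marginal_ne_zero hne a ⟨.inr ha, ha.2⟩

/-- The clique condition at a chain component, required only where the conditioning event has
positive probability. -/
def LocalFac (E : Set (V × V)) (A : Set V) (f : (∀ v, X v) → ℝ) (τ : Set V) : Prop :=
  ∃ g, CliqueFac (moral (gInduced E (τ ∪ gPaTau E τ))) g ∧
    ∀ x, marginal f (gPaTau E τ ∪ (τ ∩ A)) x ≠ 0 →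
      kern E A f τ x = g x / sumOver (τ \ A) g x

lemma localFac_iff (hr : IsRank E r) (hcons : ConsistentWith f A a0) {τ : Set V}
    (hτ : τ ∈ gComps E) :
    LocalFac E A f τ ↔ ∃ g, CliqueFac (moral (gInduced E (τ ∪ gPaTau E τ))) g ∧
      ∀ x, kern E A f τ x = g x / sumOver (τ \ A) g x := by
  constructor
  · rintro ⟨g, hg, hk⟩
    refine ⟨_, (cliqueFac_indicator_marginal hr hcons hτ).mul hg, fun x => ?_⟩
    rw [sumOver_mul_left]
    · by_cases hx : marginal f (gPaTau E τ ∪ (τ ∩ A)) x = 0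
      · simp [hx, kern_eq]
      · simp [hx, hk x hx]
    · intro x y h
      simp only [(dependsOn_marginal f _).mono (given_subset_compl E A τ) x y h]
  · rintro ⟨g, hg, hk⟩
    exact ⟨g, hg, fun x _ => hk x⟩

lemma factorizesCGInt_iff (hr : IsRank E r) (hf : IsPMF f) (hcons : ConsistentWith f A a0) :
    FactorizesCGInt E A f ↔ (∀ x, f x ≠ 0 → f x = ∏ c ∈ compFinset E, kern E A f c x) ∧
      ∀ τ ∈ gComps E, LocalFac E A f τ := by
  have hprod : ∀ x, ∏ᶠ τ ∈ gComps E, condM f (τ \ A) (gPaTau E τ ∪ (τ ∩ A)) x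
      = ∏ c ∈ compFinset E, kern E A f c x :=
    fun x => finprod_mem_eq_finite_toFinset_prod _ _
  have hloc : (∀ τ ∈ gComps E, LocalFac E A f τ) ↔ ∀ τ ∈ gComps E,
      ∃ g, CliqueFac (moral (gInduced E (τ ∪ gPaTau E τ))) g ∧
        ∀ x, kern E A f τ x = g x / sumOver (τ \ A) g x :=
    forall₂_congr fun τ hτ => localFac_iff hr hcons hτ
  rw [hloc, FactorizesCGInt]
  simp only [hprod]
  refine and_congr ⟨fun h x _ => h x, eq_prod_kern_of_ne_zero hr hf hcons⟩
    (forall₂_congr fun τ _ => ⟨?_, ?_⟩)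
  · rintro ⟨ψ, hψ, hk⟩
    exact ⟨_, ⟨ψ, hψ, fun _ => rfl⟩, hk⟩
  · rintro ⟨g, ⟨ψ, hψ, hg⟩, hk⟩
    obtain rfl := funext hg
    exact ⟨ψ, hψ, hk⟩

end Kernel

section Redirect

variable {V : Type*} [Fintype V] {E : Set (V × V)} {A : Set V} {r : V → ℕ}

/-- The chain components of the redirected graph contained in `τ \ A`. -/
noncomputable def freeComps (E : Set (V × V)) (A τ : Set V) : Finset (Set V) :=
  {c ∈ compFinset (redirectCG E A) | c ⊆ τ \ A}

lemma mem_freeComps {τ c : Set V} :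
    c ∈ freeComps E A τ ↔ c ∈ gComps (redirectCG E A) ∧ c ⊆ τ \ A := by
  simp [freeComps, mem_compFinset]

lemma disjoint_of_mem_freeComps {τ c : Set V} (hc : c ∈ freeComps E A τ) : Disjoint c A :=
  Set.disjoint_left.2 fun _ hv => ((mem_freeComps.1 hc).2 hv).2

lemma subset_of_mem_freeComps {τ c : Set V} (hc : c ∈ freeComps E A τ) : c ⊆ τ :=
  (mem_freeComps.1 hc).2.trans Set.sdiff_subset

lemma gComp_redirectCG_mem_freeComps {τ : Set V} (hτ : τ ∈ gComps E) {v : V} (hv : v ∈ τ)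
    (hvA : v ∉ A) : gComp (redirectCG E A) v ∈ freeComps E A τ := by
  have hc := gComp_mem_gComps (E := redirectCG E A) v
  refine mem_freeComps.2 ⟨hc, fun u hu => ⟨?_, ?_⟩⟩
  · obtain ⟨τ', hτ', hsub⟩ := exists_subset_of_mem_gComps_redirectCG hc
    rw [gComps_eq_of_mem hτ hτ' hv (hsub (mem_gComp_self v))]
    exact hsub hu
  · rcases singleton_or_disjoint_of_mem_gComps_redirectCG hc with ⟨a, ha, hca⟩ | h
    · have := mem_gComp_self (E := redirectCG E A) v
      rw [hca, Set.mem_singleton_iff] at this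
      exact absurd (this ▸ ha) hvA
    · exact Set.disjoint_left.1 h hu

lemma biUnion_freeComps {τ : Set V} (hτ : τ ∈ gComps E) :
    (⋃ c ∈ freeComps E A τ, c) = τ \ A := by
  ext v
  simp only [Set.mem_iUnion, exists_prop]
  constructor
  · rintro ⟨c, hc, hv⟩
    exact (mem_freeComps.1 hc).2 hv
  · rintro ⟨hv, hvA⟩
    exact ⟨_, gComp_redirectCG_mem_freeComps hτ hv hvA, mem_gComp_self v⟩

lemma freeComps_disjoint {τ c c' : Set V} (hc : c ∈ freeComps E A τ)
    (hc' : c' ∈ freeComps E A τ) (h : c ≠ c') : Disjoint c c' :=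
  gComps_disjoint (mem_freeComps.1 hc).1 (mem_freeComps.1 hc').1 h

lemma IsRank.closure_freeComps_subset (hr : IsRank E r) {τ c : Set V} (hτ : τ ∈ gComps E)
    (hc : c ∈ freeComps E A τ) : c ∪ gPaTau (redirectCG E A) c ⊆ τ ∪ gPaTau E τ := by
  refine Set.union_subset ((subset_of_mem_freeComps hc).trans Set.subset_union_left) ?_
  exact (hr.gPaTau_redirectCG_subset hτ (subset_of_mem_freeComps hc)).trans (given_subset E A τ)

lemma IsRank.closure_freeComps_subset_compl (hr : IsRank E r) {τ c c' : Set V}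
    (hτ : τ ∈ gComps E) (hc : c ∈ freeComps E A τ) (hc' : c' ∈ freeComps E A τ) (h : c ≠ c') :
    c ∪ gPaTau (redirectCG E A) c ⊆ c'ᶜ := by
  refine Set.union_subset (Set.disjoint_left.1 (freeComps_disjoint hc hc' h)) ?_
  refine (hr.gPaTau_redirectCG_subset hτ (subset_of_mem_freeComps hc)).trans ?_
  exact (given_subset_compl E A τ).trans (Set.compl_subset_compl.2 (mem_freeComps.1 hc').2)

end Redirect

section Transfer

variable {V : Type*} [Fintype V] [DecidableEq V] {X : V → Type*} [∀ v, Fintype (X v)]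
  {E : Set (V × V)} {A : Set V} {r : V → ℕ} {a0 : ∀ v, X v} {f : (∀ v, X v) → ℝ}

lemma kern_singleton {a : V} (ha : a ∈ A) (x : ∀ v, X v) (hx : marginal f {a} x ≠ 0) :
    kern (redirectCG E A) A f {a} x = 1 := by
  rw [kern_eq, gPaTau_redirectCG_singleton ha, Set.union_empty, Set.empty_union,
    Set.inter_eq_left.2 (Set.singleton_subset_iff.2 ha), div_self hx]

lemma kern_of_disjoint {c : Set V} (hc : Disjoint c A) (x : ∀ v, X v) :
    kern E A f c x = condM f c (gPaTau E c) x := by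
  rw [kern, sdiff_eq_left.2 hc, Set.disjoint_iff_inter_eq_empty.1 hc, Set.union_empty]

lemma prod_kern_redirectCG (hf : ∀ x, 0 ≤ f x) {x : ∀ v, X v} (hx : f x ≠ 0)
    (h : ∀ τ ∈ gComps E, kern E A f τ x
      = ∏ c ∈ freeComps E A τ, kern (redirectCG E A) A f c x) :
    ∏ c ∈ compFinset (redirectCG E A), kern (redirectCG E A) A f c x
      = ∏ τ ∈ compFinset E, kern E A f τ x := by
  rw [Finset.prod_congr rfl fun τ hτ => h τ (mem_compFinset.1 hτ), ← Finset.prod_biUnion]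
  · refine (Finset.prod_subset (fun c hc => ?_) fun c hc hc' => ?_).symm
    · obtain ⟨τ, -, hc⟩ := Finset.mem_biUnion.1 hc
      exact mem_compFinset.2 (mem_freeComps.1 hc).1
    · rw [mem_compFinset] at hc
      rcases singleton_or_disjoint_of_mem_gComps_redirectCG hc with ⟨a, ha, rfl⟩ | hcA
      · exact kern_singleton ha x (marginal_ne_zero_of_ne_zero hf _ hx)
      · obtain ⟨τ, hτ, hcτ⟩ := exists_subset_of_mem_gComps_redirectCG hc
        exact absurd (Finset.mem_biUnion.2 ⟨τ, mem_compFinset.2 hτ, mem_freeComps.2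
          ⟨hc, Set.subset_sdiff.2 ⟨hcτ, hcA⟩⟩⟩) hc'
  · intro τ hτ τ' hτ' hne
    refine Finset.disjoint_left.2 fun c hc hc' => hne ?_
    obtain ⟨v, hv⟩ := gComps_nonempty (mem_freeComps.1 hc).1
    exact gComps_eq_of_mem (mem_compFinset.1 hτ) (mem_compFinset.1 hτ')
      (subset_of_mem_freeComps hc hv) (subset_of_mem_freeComps hc' hv)

lemma localFac_singleton {a : V} (ha : a ∈ A) : LocalFac (redirectCG E A) A f {a} := by
  refine ⟨_, cliqueFac_one, fun x hx => ?_⟩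
  have hsub : ({a} : Set V) ⊆ A := Set.singleton_subset_iff.2 ha
  rw [gPaTau_redirectCG_singleton ha, Set.empty_union, Set.inter_eq_left.2 hsub] at hx
  rw [kern_singleton ha x hx, Set.sdiff_eq_empty.2 hsub, sumOver_empty, div_one]

lemma condM_eq_of_factor {C P D : Set V} (hCP : Disjoint C P) (hD : C ∪ P ⊆ D)
    {q g : (∀ v, X v) → ℝ} (hq : DependsOn q Cᶜ) (hg : DependsOn g (C ∪ P))
    (h : ∀ x, marginal f D x = q x * g x) {x : ∀ v, X v} (hx : marginal f P x ≠ 0) :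
    condM f C P x = g x / sumOver C g x := by
  have h1 : marginal f (C ∪ P) = fun y => sumOver (D \ (C ∪ P)) q y * g y := by
    ext y
    rw [marginal_eq_sumOver_marginal f hD, funext h]
    simp only [mul_comm (q _)]
    rw [sumOver_mul_left (hg.mono fun v hv hv' => hv'.2 hv), mul_comm]
  have h2 : marginal f P x = sumOver (D \ (C ∪ P)) q x * sumOver C g x := by
    rw [marginal_eq_sumOver_marginal f (Set.subset_union_right : P ⊆ C ∪ P),
      Set.union_sdiff_right, sdiff_eq_left.2 hCP, h1,
      sumOver_mul_left ((hq.sumOver _).mono Set.sdiff_subset)]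
  rw [condM, h2, h1]
  rw [h2] at hx
  exact mul_div_mul_left _ _ (left_ne_zero_of_mul hx)

/-- A clique factorization at a chain component of `E` splits over the components of the
redirected graph inside it. -/
lemma LocalFac.redirect (hr : IsRank E r) (hf : ∀ x, 0 ≤ f x) {τ : Set V} (hτ : τ ∈ gComps E)
    (h : LocalFac E A f τ) :
    (∀ c ∈ freeComps E A τ, LocalFac (redirectCG E A) A f c) ∧
    ∀ x, f x ≠ 0 → kern E A f τ x
      = ∏ c ∈ freeComps E A τ, kern (redirectCG E A) A f c x := by
  obtain ⟨g, ⟨ψ, hψ, hgψ⟩, hk⟩ := h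
  obtain ⟨w, -⟩ := gComps_nonempty hτ
  have : Nonempty V := ⟨w⟩
  set M := moral (gInduced E (τ ∪ gPaTau E τ))
  simp only [finprod_maxCliques] at hgψ
  let G : Set V → (∀ v, X v) → ℝ := fun c x =>
    ∏ K ∈ maxCliqueFinset M with (K ∩ c).Nonempty, ψ K x
  let H : Set V → (∀ v, X v) → ℝ := fun c x =>
    ∏ K ∈ maxCliqueFinset M with ¬ (K ∩ c).Nonempty, ψ K x
  have hGH : ∀ c x, g x = G c x * H c x := fun c x => by
    rw [hgψ, Finset.prod_filter_mul_prod_filter_not]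
  have hclq : ∀ c ∈ freeComps E A τ, ∀ K ∈ maxCliqueFinset M, (K ∩ c).Nonempty →
      K ⊆ c ∪ gPaTau (redirectCG E A) c ∧ IsCliqueIn (moral (gInduced (redirectCG E A)
        (c ∪ gPaTau (redirectCG E A) c))) K := fun c hc K hK hKc =>
    hr.clique_redirectCG hτ (mem_freeComps.1 hc).1 (subset_of_mem_freeComps hc)
      (disjoint_of_mem_freeComps hc) (mem_maxCliqueFinset.1 hK).2.2.1 hKc
  have hGdep : ∀ c ∈ freeComps E A τ,
      DependsOn (G c) (c ∪ gPaTau (redirectCG E A) c) := fun c hc =>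
    DependsOn.prod fun K hK => by
      obtain ⟨hK, hKc⟩ := Finset.mem_filter.1 hK
      exact (hψ K (mem_maxCliqueFinset.1 hK)).2.mono (hclq c hc K hK hKc).1
  have hHdep : ∀ c, DependsOn (H c) cᶜ := fun c =>
    DependsOn.prod fun K hK => by
      obtain ⟨hK, hKc⟩ := Finset.mem_filter.1 hK
      exact (hψ K (mem_maxCliqueFinset.1 hK)).2.mono fun v hv hvc => hKc ⟨v, hv, hvc⟩
  have hker : ∀ c ∈ freeComps E A τ, ∀ x, marginal f (gPaTau (redirectCG E A) c) x ≠ 0 →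
      kern (redirectCG E A) A f c x = G c x / sumOver c (G c) x := by
    intro c hc x hx
    have hcsub : c ⊆ τ \ A := (mem_freeComps.1 hc).2
    rw [kern_of_disjoint (disjoint_of_mem_freeComps hc)]
    refine condM_eq_of_factor (D := τ ∪ gPaTau E τ)
      (q := fun x => marginal f (gPaTau E τ ∪ (τ ∩ A)) x / sumOver (τ \ A) g x * H c x)
      (Set.disjoint_left.2 fun v hv hv' => (mem_gPaTau.1 hv').2 hv)
      (hr.closure_freeComps_subset hτ hc) (DependsOn.mul (DependsOn.div ?_ ?_) (hHdep c))
      (hGdep c hc) (fun y => ?_) hx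
    · exact (dependsOn_marginal f _).mono
        ((given_subset_compl E A τ).trans (Set.compl_subset_compl.2 hcsub))
    · exact ((dependsOn_univ g).sumOver _).mono fun v hv hvc => hv.2 (hcsub hvc)
    · rw [marginal_eq_mul_kern (A := A) hf]
      by_cases hy : marginal f (gPaTau E τ ∪ (τ ∩ A)) y = 0
      · simp [hy]
      · rw [hk y hy, hGH c y]
        ring
  refine ⟨fun c hc => ⟨G c, CliqueFac.prod fun K hK => ?_, fun x hx => ?_⟩, fun x hx => ?_⟩
  · obtain ⟨hK, hKc⟩ := Finset.mem_filter.1 hK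
    obtain ⟨h0, hdep⟩ := hψ K (mem_maxCliqueFinset.1 hK)
    exact cliqueFac_of_isCliqueIn (hclq c hc K hK hKc).2 h0 hdep
  · have hcA := disjoint_of_mem_freeComps hc
    rw [Set.disjoint_iff_inter_eq_empty.1 hcA, Set.union_empty] at hx
    rw [sdiff_eq_left.2 hcA]
    exact hker c hc x hx
  · have hGprod : ∀ y, ∏ c ∈ freeComps E A τ, G c y = G (τ \ A) y := by
      intro y
      simp only [G, Finset.prod_filter]
      rw [Finset.prod_comm]
      refine Finset.prod_congr rfl fun K hK => ?_
      split_ifs with hKτ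
      · obtain ⟨v, hvK, hvτ, hvA⟩ := hKτ
        have hc := gComp_redirectCG_mem_freeComps hτ hvτ hvA
        rw [Finset.prod_eq_single (gComp (redirectCG E A) v), if_pos ⟨v, hvK, mem_gComp_self v⟩]
        · intro c' hc' hne
          refine if_neg ?_
          rintro ⟨u, huK, huc⟩
          exact hr.closure_freeComps_subset_compl hτ hc hc' hne.symm
            ((hclq _ hc K hK ⟨v, hvK, mem_gComp_self v⟩).1 huK) huc
        · exact fun h => absurd hc h
      · refine Finset.prod_eq_one fun c hc => if_neg ?_
        rintro ⟨u, huK, huc⟩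
        exact hKτ ⟨u, huK, (mem_freeComps.1 hc).2 huc⟩
    have hg : g = fun y => H (τ \ A) y * ∏ c ∈ freeComps E A τ, G c y := by
      ext y
      rw [hGprod, mul_comm, ← hGH]
    have hkx := hk x (marginal_ne_zero_of_ne_zero hf _ hx)
    have hne : g x ≠ 0 := fun h0 => kern_ne_zero (E := E) (A := A) hf τ hx (by
      rw [hkx, h0, zero_div])
    rw [hGH (τ \ A) x] at hne
    have hsum := sumOver_biUnion_prod (freeComps E A τ) G
      (fun c hc c' hc' h => freeComps_disjoint hc hc' h)
      (fun c hc c' hc' h => (hGdep c hc).mono (hr.closure_freeComps_subset_compl hτ hc hc' h)) x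
    rw [biUnion_freeComps hτ] at hsum
    rw [hkx, hg, sumOver_mul_left (hHdep _), hsum,
      mul_div_mul_left _ _ (right_ne_zero_of_mul hne), ← Finset.prod_div_distrib]
    exact Finset.prod_congr rfl fun c hc =>
      (hker c hc x (marginal_ne_zero_of_ne_zero hf _ hx)).symm

lemma kern_eq_prod_of_factorizes_redirectCG (hr : IsRank E r) (hf : IsPMF f)
    (hcons : ConsistentWith f A a0)
    (h : ∀ x, f x = ∏ c ∈ compFinset (redirectCG E A), kern (redirectCG E A) A f c x)
    {τ : Set V} (hτ : τ ∈ gComps E) {x : ∀ v, X v}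
    (hx : marginal f (gPaTau E τ ∪ (τ ∩ A)) x ≠ 0) :
    kern E A f τ x = ∏ c ∈ freeComps E A τ, kern (redirectCG E A) A f c x := by
  obtain ⟨w, hw⟩ := gComps_nonempty hτ
  set S : Set V := A ∪ {v | r v < r w} with hS
  let C : Finset (Set V) := {c ∈ compFinset (redirectCG E A) | c ⊆ S}
  have hCmem : ∀ {c}, c ∈ C ↔ c ∈ gComps (redirectCG E A) ∧ c ⊆ S := by
    intro c
    simp [C, mem_compFinset]
  have hCS : (⋃ c ∈ C, c) = S := by
    ext v
    simp only [Set.mem_iUnion, exists_prop]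
    constructor
    · rintro ⟨c, hc, hv⟩
      exact (hCmem.1 hc).2 hv
    · intro hv
      have hc := gComp_mem_gComps (E := redirectCG E A) v
      refine ⟨_, hCmem.2 ⟨hc, ?_⟩, mem_gComp_self v⟩
      rcases singleton_or_disjoint_of_mem_gComps_redirectCG hc with ⟨a, ha, hca⟩ | hd
      · rw [hca, Set.singleton_subset_iff]
        exact .inl ha
      · intro u hu
        obtain ⟨τ', hτ', hsub⟩ := exists_subset_of_mem_gComps_redirectCG hc
        have hvA := Set.disjoint_left.1 hd (mem_gComp_self v)
        exact .inr ((hr.eq_of_mem hτ' (hsub hu) (hsub (mem_gComp_self v))).trans_lt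
          (hv.resolve_left hvA))
  have hpaC : ∀ c ∈ C, gPaTau (redirectCG E A) c ⊆ S := by
    intro c hc u hu
    obtain ⟨hc, hcS⟩ := hCmem.1 hc
    obtain ⟨τ', hτ', hsub⟩ := exists_subset_of_mem_gComps_redirectCG hc
    obtain ⟨⟨v, hv, huv⟩, -⟩ := mem_gPaTau.1 hu
    have hvw : r v < r w := (hcS hv).resolve_left (gPar_redirectCG.1 huv).1
    rcases hr.gPaTau_redirectCG_subset hτ' hsub hu with h | h
    · exact .inr ((hr.lt_of_mem_gPaTau hτ' h (hsub hv)).trans hvw)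
    · exact .inl h.2
  have hTS : gPaTau E τ ∪ (τ ∩ A) ⊆ S := by
    rintro v (hv | hv)
    · exact .inr (hr.lt_of_mem_gPaTau hτ hv hw)
    · exact .inl hv.2
  have hSτ : ∀ v ∈ τ, v ∈ S → v ∈ A := by
    rintro v hv (h | h)
    · exact h
    · exact absurd (hr.eq_of_mem hτ hv hw) (ne_of_lt h)
  have hunion : (⋃ c ∈ C ∪ freeComps E A τ, c) = S ∪ τ \ A := by
    rw [Finset.set_biUnion_union, hCS, biUnion_freeComps hτ]
  have hdisj : Disjoint C (freeComps E A τ) := by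
    refine Finset.disjoint_left.2 fun c hc hc' => ?_
    obtain ⟨v, hv⟩ := gComps_nonempty (hCmem.1 hc).1
    have := (mem_freeComps.1 hc').2 hv
    exact this.2 (hSτ v this.1 ((hCmem.1 hc).2 hv))
  have hr' := hr.redirect A
  have hm1 := marginal_biUnion_eq_prod_kern hr' hf hcons h (C := C) (Finset.filter_subset _ _)
    (by rw [hCS]; exact hpaC)
  have hm2 := marginal_biUnion_eq_prod_kern hr' hf hcons h (C := C ∪ freeComps E A τ)
    (Finset.union_subset (Finset.filter_subset _ _) (Finset.filter_subset _ _)) (by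
      rw [hunion]
      intro c hc
      rcases Finset.mem_union.1 hc with hc | hc
      · exact (hpaC c hc).trans Set.subset_union_left
      · exact ((hr.gPaTau_redirectCG_subset hτ (subset_of_mem_freeComps hc)).trans hTS).trans
          Set.subset_union_left)
  rw [hCS] at hm1
  rw [hunion] at hm2
  let κ : (∀ v, X v) → ℝ := fun y => ∏ c ∈ freeComps E A τ, kern (redirectCG E A) A f c y
  have hκ : DependsOn κ (τ ∪ gPaTau E τ) := DependsOn.prod fun c hc =>
    (dependsOn_kern _ A f c).mono (hr.closure_freeComps_subset hτ hc)
  have hm : marginal f (S ∪ τ \ A) = fun y => κ y * marginal f S y := by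
    ext y
    rw [hm1, hm2, Finset.prod_union hdisj, mul_comm]
  have hsub : τ ∪ gPaTau E τ ⊆ S ∪ τ \ A := by
    rw [← diff_union_given E A τ, Set.union_comm]
    exact Set.union_subset_union_left _ hTS
  have hset : (S ∪ τ \ A) \ (τ ∪ gPaTau E τ) = S \ (gPaTau E τ ∪ (τ ∩ A)) := by
    ext v
    have := hSτ v
    simp only [Set.mem_union, Set.mem_sdiff, Set.mem_inter_iff]
    tauto
  rw [kern_eq, marginal_eq_sumOver_marginal f hsub, hm,
    sumOver_mul_left (hκ.mono fun v hv hv' => hv'.2 hv), hset,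
    ← marginal_eq_sumOver_marginal f hTS, mul_div_assoc, div_self hx, mul_one]

lemma sumOver_comp_restrictTo {S D : Set V} (hSD : S ⊆ D) (g : (∀ v, X v) → ℝ)
    (b x : ∀ v, X v) :
    sumOver S (fun y => g (restrictTo D b y)) x = sumOver S g (restrictTo D b x) := by
  refine sumOver_congr_of_forall fun y y' hy hy' hyy => congrArg g (funext fun v => ?_)
  by_cases hvS : v ∈ S
  · simp [restrictTo, hSD hvS, hyy v hvS]
  · rw [hy' v hvS]
    by_cases hvD : v ∈ D
    · simp [restrictTo, hvD, hy v hvS]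
    · simp [restrictTo, hvD]

lemma LocalFac.of_redirect (hr : IsRank E r) (hcons : ConsistentWith f A a0)
    {τ : Set V} (hτ : τ ∈ gComps E)
    (hloc : ∀ c ∈ freeComps E A τ, LocalFac (redirectCG E A) A f c)
    (hmarg : ∀ x, marginal f (gPaTau E τ ∪ (τ ∩ A)) x ≠ 0 →
      ∀ c ∈ freeComps E A τ, marginal f (gPaTau (redirectCG E A) c) x ≠ 0)
    (hker : ∀ x, marginal f (gPaTau E τ ∪ (τ ∩ A)) x ≠ 0 →
      kern E A f τ x = ∏ c ∈ freeComps E A τ, kern (redirectCG E A) A f c x) :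
    LocalFac E A f τ := by
  obtain ⟨w, -⟩ := gComps_nonempty hτ
  have : Nonempty V := ⟨w⟩
  have hloc' : ∀ c, ∃ g, c ∈ freeComps E A τ → CliqueFac (moral (gInduced (redirectCG E A)
      (c ∪ gPaTau (redirectCG E A) c))) g ∧
      ∀ x, marginal f (gPaTau (redirectCG E A) c) x ≠ 0 →
        kern (redirectCG E A) A f c x = g x / sumOver c g x := by
    intro c
    by_cases hc : c ∈ freeComps E A τ
    · obtain ⟨g, hg, hk⟩ := hloc c hc
      have hcA := disjoint_of_mem_freeComps hc
      rw [Set.disjoint_iff_inter_eq_empty.1 hcA, Set.union_empty, sdiff_eq_left.2 hcA] at hk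
      exact ⟨g, fun _ => ⟨hg, hk⟩⟩
    · exact ⟨0, fun h => absurd h hc⟩
  choose g hg using hloc'
  let D : Set V → Set V := fun c => (c ∪ gPaTau (redirectCG E A) c) \ A
  have hcD : ∀ c ∈ freeComps E A τ, c ⊆ D c := fun c hc v hv =>
    ⟨.inl hv, Set.disjoint_left.1 (disjoint_of_mem_freeComps hc) hv⟩
  have hdep : ∀ c, DependsOn (fun x => g c (restrictTo (D c) a0 x))
      (c ∪ gPaTau (redirectCG E A) c) := fun c =>
    ((dependsOn_univ (g c)).comp_restrictTo (D c) a0).mono fun v hv => hv.2.1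
  refine ⟨fun x => ∏ c ∈ freeComps E A τ, g c (restrictTo (D c) a0 x),
    CliqueFac.prod fun c hc => ?_, fun x hx => ?_⟩
  · obtain ⟨ψ, hψ, hgψ⟩ := (hg c hc).1
    simp only [hgψ, finprod_maxCliques]
    refine CliqueFac.prod fun K hK => ?_
    obtain ⟨h0, hdepK⟩ := hψ K (mem_maxCliqueFinset.1 hK)
    exact cliqueFac_of_isCliqueIn (hr.clique_of_redirectCG hτ (mem_freeComps.1 hc).1
      (subset_of_mem_freeComps hc) (mem_maxCliqueFinset.1 hK).2.2.1) (fun x => h0 _)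
      ((hdepK.comp_restrictTo (D c) a0).mono fun v hv => ⟨hv.1, hv.2.2⟩)
  · have hsum := sumOver_biUnion_prod (freeComps E A τ)
      (fun c y => g c (restrictTo (D c) a0 y))
      (fun c hc c' hc' h => freeComps_disjoint hc hc' h)
      (fun c hc c' hc' h => (hdep c).mono (hr.closure_freeComps_subset_compl hτ hc hc' h)) x
    rw [biUnion_freeComps hτ] at hsum
    rw [hker x hx, hsum, ← Finset.prod_div_distrib]
    refine Finset.prod_congr rfl fun c hc => ?_
    have hagree : ∀ v ∈ c ∪ gPaTau (redirectCG E A) c, restrictTo (D c) a0 x v = x v := by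
      intro v hv
      by_cases hvA : v ∈ A
      · have hvD : v ∉ D c := fun h => h.2 hvA
        have hvc : v ∉ c := fun h => Set.disjoint_left.1 (disjoint_of_mem_freeComps hc) h hvA
        rw [restrictTo_of_notMem hvD]
        exact (hcons.eq_of_marginal_ne_zero hx v ⟨hr.gPaTau_redirectCG_subset hτ
          (subset_of_mem_freeComps hc) (hv.resolve_left hvc), hvA⟩).symm
      · exact restrictTo_of_mem (show v ∈ D c from ⟨hv, hvA⟩) _ _
    have hm : marginal f (gPaTau (redirectCG E A) c) (restrictTo (D c) a0 x) ≠ 0 := by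
      rw [dependsOn_marginal f _ _ x fun v hv => hagree v (.inr hv)]
      exact hmarg x hx c hc
    rw [← dependsOn_kern _ A f c _ x hagree, (hg c hc).2 _ hm,
      sumOver_comp_restrictTo (hcD c hc)]

end Transfer

end BH

/-- A chain graph `G` with intervened set `A` and the graph `Ĝ`
obtained from `G` by the redirection procedure admit the same factorization
decomposition: a pmf supported on configurations consistent with `x_A = a₀`
factorizes according to `(G, A)` iff it factorizes according to `(Ĝ, A)`. -/
theorem statement17 {V : Type*} [Fintype V] [DecidableEq V]
    {X : V → Type*} [∀ v, Fintype (X v)]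
    (E : Set (V × V)) (hG : BH.IsChainGraph E)
    (A : Set V) (a0 : ∀ v, X v)
    (f : (∀ v, X v) → ℝ) (hf : BH.IsPMF f) (hcons : BH.ConsistentWith f A a0) :
    BH.FactorizesCGInt E A f ↔ BH.FactorizesCGInt (BH.redirectCG E A) A f := by
  obtain ⟨r, hr⟩ := BH.exists_isRank hG
  have hr' := hr.redirect A
  rw [BH.factorizesCGInt_iff hr hf hcons, BH.factorizesCGInt_iff hr' hf hcons]
  constructor
  · rintro ⟨hp, hl⟩
    have key := fun τ hτ => (hl τ hτ).redirect hr hf.1 hτ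
    refine ⟨fun x hx => (hp x hx).trans
      (BH.prod_kern_redirectCG hf.1 hx fun τ hτ => (key τ hτ).2 x hx).symm, fun c hc => ?_⟩
    rcases BH.singleton_or_disjoint_of_mem_gComps_redirectCG hc with ⟨a, ha, rfl⟩ | hcA
    · exact BH.localFac_singleton ha
    · obtain ⟨τ, hτ, hcτ⟩ := BH.exists_subset_of_mem_gComps_redirectCG hc
      exact (key τ hτ).1 c (BH.mem_freeComps.2 ⟨hc, Set.subset_sdiff.2 ⟨hcτ, hcA⟩⟩)
  · rintro ⟨hp, hl⟩
    have hp' := BH.eq_prod_kern_of_ne_zero hr' hf hcons hp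
    have key := fun τ hτ x hx =>
      BH.kern_eq_prod_of_factorizes_redirectCG (τ := τ) (x := x) hr hf hcons hp' hτ hx
    exact ⟨fun x hx => (hp x hx).trans (BH.prod_kern_redirectCG hf.1 hx fun τ hτ =>
        key τ hτ x (BH.marginal_ne_zero_of_ne_zero hf.1 _ hx)),
      fun τ hτ => BH.LocalFac.of_redirect hr hcons hτ
        (fun c hc => hl c (BH.mem_freeComps.1 hc).1)
        (fun x hx c hc => BH.marginal_ne_zero_of_subset hf.1
          (hr.gPaTau_redirectCG_subset hτ (BH.subset_of_mem_freeComps hc)) hx) (key τ hτ)⟩
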